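/- Assume Condition (C) holds and ρ_k = 1 − 3r_k + O(r_k²) as k → ∞. Then: if β > 1, almost surely X has at most finitely many cutpoints; if β ≤ 1, almost surely X has infinitely many cutpoints. -/

import Mathlib

open Filter MeasureTheory ENNReal Topology Asymptotics

noncomputable section

/-- Transition function of the (2,1) random walk `X`. -/
def transX (q p1 p2 : ℕ → ℝ) (n j : ℕ) : ℝ :=
  if n = 0 then (if j = 1 then 1 else 0)
  else if n = 1 then (if j = 2 then 1 else 0)
  else if j = n + 1 then q n
  else if j = n - 1 then p1 n
  else if j = n - 2 then p2 n
  else 0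

/-- `μ` is the law (on path space) of the time-homogeneous Markov chain on `ℕ`
with one-step transition probabilities `p` and initial state `init`. -/
def IsMarkovChain (μ : Measure (ℕ → ℕ)) (p : ℕ → ℕ → ℝ) (init : ℕ) : Prop :=
  μ {ω | ω 0 = init} = 1 ∧
  ∀ (k : ℕ) (x : ℕ → ℕ) (j : ℕ),
    μ {ω | (∀ i ≤ k, ω i = x i) ∧ ω (k + 1) = j}
      = ENNReal.ofReal (p (x k) j) * μ {ω | ∀ i ≤ k, ω i = x i}

/-- `ρ_k`, the spectral radius of the matrix `A_k`. -/
def rho (q p1 p2 : ℕ → ℝ) (k : ℕ) : ℝ :=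
  ((p1 k + p2 k) / q k
    + Real.sqrt (((p1 k + p2 k) / q k) ^ 2 + 4 * (p2 k / q k))) / 2

/-- The perturbation `r_n = (1/3)(1/n + 1/(n (log log n)^β))` for `n ≥ 4`,
and `r_2 = r_3 = r_4`. -/
def rseq (β : ℝ) (n : ℕ) : ℝ :=
  if 4 ≤ n then
    (1 / 3) * (1 / (n : ℝ) + 1 / ((n : ℝ) * Real.log (Real.log (n : ℝ)) ^ β))
  else
    (1 / 3) * (1 / (4 : ℝ) + 1 / ((4 : ℝ) * Real.log (Real.log (4 : ℝ)) ^ β))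

/-- The shifted path. -/
def shiftP (n : ℕ) (ω : ℕ → ℕ) : ℕ → ℕ := fun i => ω (n + i)

/-- `F` depends only on the coordinates `≤ n`. -/
def DepOn (n : ℕ) (F : Set (ℕ → ℕ)) : Prop :=
  ∀ ω ω' : ℕ → ℕ, (∀ i ≤ n, ω i = ω' i) → ω ∈ F → ω' ∈ F

def resP (n : ℕ) (ω : ℕ → ℕ) : Fin (n + 1) → ℕ := fun i => ω i

lemma measurable_resP (n : ℕ) : Measurable (resP n) :=
  measurable_pi_lambda _ fun i => measurable_pi_apply _

lemma measurable_shiftP (n : ℕ) : Measurable (shiftP n) :=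
  measurable_pi_lambda _ fun i => measurable_pi_apply _

lemma DepOn.eq_preimage {n : ℕ} {F : Set (ℕ → ℕ)} (h : DepOn n F) :
    F = resP n ⁻¹' (resP n '' F) := by
  ext ω
  constructor
  · intro hω; exact ⟨ω, hω, rfl⟩
  · rintro ⟨ω', hω', he⟩
    refine h ω' ω (fun i hi => ?_) hω'
    exact congrFun he ⟨i, Nat.lt_succ_of_le hi⟩

lemma DepOn.measurableSet {n : ℕ} {F : Set (ℕ → ℕ)} (h : DepOn n F) : MeasurableSet F := by
  rw [h.eq_preimage]
  exact measurable_resP n (Set.to_countable _).measurableSet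

lemma preimage_resP_singleton (n : ℕ) (x : ℕ → ℕ) :
    resP n ⁻¹' {resP n x} = {ω | ∀ i ≤ n, ω i = x i} := by
  ext ω
  simp only [Set.mem_preimage, Set.mem_singleton_iff, Set.mem_ofPred_eq]
  constructor
  · intro h i hi; exact congrFun h ⟨i, Nat.lt_succ_of_le hi⟩
  · intro h; funext i; exact h i (Nat.le_of_lt_succ i.2)

lemma depOn_cyl (n : ℕ) (x : ℕ → ℕ) : DepOn n {ω | ∀ i ≤ n, ω i = x i} := by
  intro ω ω' h hω i hi
  rw [← h i hi]; exact hω i hi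

lemma DepOn.inter {n : ℕ} {F G : Set (ℕ → ℕ)} (h : DepOn n F) (h' : DepOn n G) :
    DepOn n (F ∩ G) := fun ω ω' hh hω => ⟨h ω ω' hh hω.1, h' ω ω' hh hω.2⟩

lemma DepOn.mono {n m : ℕ} {F : Set (ℕ → ℕ)} (h : DepOn n F) (hnm : n ≤ m) : DepOn m F :=
  fun ω ω' hh hω => h ω ω' (fun i hi => hh i (hi.trans hnm)) hω

lemma depOn_eval (n m : ℕ) (hm : m ≤ n) (j : ℕ) : DepOn n {ω | ω m = j} := by
  intro ω ω' h hω
  simp only [Set.mem_ofPred_eq] at *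
  rw [← h m hm]; exact hω

/-- the cylinders generate. -/
lemma ext_cyl (ν ν' : Measure (ℕ → ℕ)) [IsFiniteMeasure ν] 
    (h : ∀ (k : ℕ) (x : ℕ → ℕ), ν {ω | ∀ i ≤ k, ω i = x i} = ν' {ω | ∀ i ≤ k, ω i = x i})
    (huniv : ν Set.univ = ν' Set.univ) :
    ν = ν' := by
  have hpi : IsPiSystem {s : Set (ℕ → ℕ) | ∃ (k : ℕ) (x : ℕ → ℕ), s = {ω | ∀ i ≤ k, ω i = x i}} := by
    rintro s ⟨k, x, rfl⟩ t ⟨l, y, rfl⟩ ⟨z, hz1, hz2⟩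
    refine ⟨max k l, z, ?_⟩
    ext ω
    simp only [Set.mem_inter_iff, Set.mem_ofPred_eq] at *
    constructor
    · rintro ⟨h1, h2⟩ i hi
      rcases le_max_iff.1 hi with h | h
      · rw [h1 i h, hz1 i h]
      · rw [h2 i h, hz2 i h]
    · intro h'
      exact ⟨fun i hi => by rw [h' i (le_max_of_le_left hi), hz1 i hi],
        fun i hi => by rw [h' i (le_max_of_le_right hi), hz2 i hi]⟩
  refine ext_of_generate_finite _ ?_ hpi ?_ huniv
  · apply le_antisymm
    · refine iSup_le fun n => ?_
      rintro s ⟨t, -, rfl⟩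
      have : (fun b : ℕ → ℕ => b n) ⁻¹' t = 
          ⋃ v ∈ (resP n '' ((fun b : ℕ → ℕ => b n) ⁻¹' t)), resP n ⁻¹' {v} := by
        have hd : DepOn n ((fun b : ℕ → ℕ => b n) ⁻¹' t) := by
          intro ω ω' h hω
          simp only [Set.mem_preimage] at *
          rw [← h n le_rfl]; exact hω
        conv_lhs => rw [hd.eq_preimage]
        ext ω; simp [eq_comm]
      rw [this]
      refine @MeasurableSet.biUnion _ _ _ _ _ (Set.to_countable _) ?_
      rintro v ⟨x, -, rfl⟩
      rw [preimage_resP_singleton]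
      exact MeasurableSpace.measurableSet_generateFrom ⟨n, x, rfl⟩
    · refine MeasurableSpace.generateFrom_le ?_
      rintro s ⟨k, x, rfl⟩
      exact (depOn_cyl k x).measurableSet
  · rintro s ⟨k, x, rfl⟩
    exact h k x

lemma IsMarkovChain.step {ν : Measure (ℕ → ℕ)} {p : ℕ → ℕ → ℝ} {y0 : ℕ}
    (h : IsMarkovChain ν p y0) {k y : ℕ} {F : Set (ℕ → ℕ)} (hF : DepOn k F)
    (hy : ∀ ω ∈ F, ω k = y) (j : ℕ) :
    ν (F ∩ {ω | ω (k + 1) = j}) = ENNReal.ofReal (p y j) * ν F := by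
  have hcount : (resP k '' F).Countable := Set.to_countable _
  have hFu : F = ⋃ v ∈ (resP k '' F), resP k ⁻¹' {v} := by
    conv_lhs => rw [hF.eq_preimage]
    ext ω; simp [eq_comm]
  have hms : ∀ v ∈ resP k '' F, MeasurableSet (resP k ⁻¹' {v}) := fun v _ =>
    measurable_resP k (Set.to_countable _).measurableSet
  have hdis : (resP k '' F).PairwiseDisjoint fun v => resP k ⁻¹' {v} := by
    intro v _ w _ hvw
    refine Set.disjoint_left.2 fun ω h1 h2 => hvw ?_
    simp only [Set.mem_preimage, Set.mem_singleton_iff] at h1 h2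
    rw [← h1, h2]
  have hmj : MeasurableSet {ω : ℕ → ℕ | ω (k + 1) = j} :=
    (depOn_eval (k + 1) (k + 1) le_rfl j).measurableSet
  have e1 : ν F = ∑' v : (resP k '' F), ν (resP k ⁻¹' {v.1}) := by
    conv_lhs => rw [hFu]
    exact measure_biUnion hcount hdis hms
  have e2 : ν (F ∩ {ω | ω (k + 1) = j}) =
      ∑' v : (resP k '' F), ν (resP k ⁻¹' {v.1} ∩ {ω | ω (k + 1) = j}) := by
    conv_lhs => rw [hFu, Set.iUnion₂_inter]
    refine measure_biUnion hcount ?_ fun v hv => (hms v hv).inter hmj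
    intro v hv w hw hvw
    exact (hdis hv hw hvw).mono Set.inter_subset_left Set.inter_subset_left
  rw [e1, e2, ← ENNReal.tsum_mul_left]
  congr 1
  funext v
  obtain ⟨v, x, hx, rfl⟩ := v
  have := h.2 k x j
  rw [hy x hx] at this
  simp only [preimage_resP_singleton]
  exact this

/-- Identification of a (sub-)Markov law. -/
lemma IsMarkovChain.unique {ν ν' : Measure (ℕ → ℕ)} [IsProbabilityMeasure ν] [IsFiniteMeasure ν']
    {p : ℕ → ℕ → ℝ} {y : ℕ} (h : IsMarkovChain ν p y) (c : ℝ≥0∞) 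
    (h0 : ∀ x : ℕ, x ≠ y → ν' {ω | ω 0 = x} = 0) (hc : ν' Set.univ = c)
    (h1 : ∀ (k : ℕ) (x : ℕ → ℕ) (j : ℕ),
    ν' {ω | (∀ i ≤ k, ω i = x i) ∧ ω (k + 1) = j}
      = ENNReal.ofReal (p (x k) j) * ν' {ω | ∀ i ≤ k, ω i = x i}) :
    ν' = c • ν := by
  have m0 : ∀ x : ℕ, MeasurableSet {ω : ℕ → ℕ | ω 0 = x} := fun x =>
    (depOn_eval 0 0 le_rfl x).measurableSet
  have hn : ∀ x : ℕ, x ≠ y → ν {ω | ω 0 = x} = 0 := by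
    intro x hx
    have : ν {ω | ω 0 = y}ᶜ = 0 := (prob_compl_eq_zero_iff (m0 y)).2 h.1
    refine measure_mono_null ?_ this
    intro ω hω; simp only [Set.mem_ofPred_eq, Set.mem_compl_iff] at *; omega
  have hy' : ν' {ω | ω 0 = y} = c := by
    rw [← hc]
    refine measure_congr ?_
    rw [ae_eq_univ]
    have : {ω : ℕ → ℕ | ω 0 = y}ᶜ ⊆ ⋃ x ∈ ({y}ᶜ : Set ℕ), {ω | ω 0 = x} := by
      intro ω hω; simp only [Set.mem_compl_iff, Set.mem_ofPred_eq] at hω; simp [hω]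
    refine measure_mono_null this ?_
    rw [measure_biUnion_null_iff (Set.to_countable _)]
    exact fun x hx => h0 x hx
  refine ext_cyl _ _ ?_ (by simp [hc])
  intro k
  induction k with
  | zero =>
    intro x
    have : {ω : ℕ → ℕ | ∀ i ≤ 0, ω i = x i} = {ω | ω 0 = x 0} := by ext; simp
    rw [this]
    by_cases hx : x 0 = y
    · rw [hx, hy']; simp [h.1]
    · simp [h0 _ hx, hn _ hx]
  | succ k ih =>
    intro x
    have : {ω : ℕ → ℕ | ∀ i ≤ k + 1, ω i = x i} =
        {ω | (∀ i ≤ k, ω i = x i) ∧ ω (k + 1) = x (k + 1)} := by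
      ext ω; simp only [Set.mem_ofPred_eq]
      constructor
      · intro h; exact ⟨fun i hi => h i (by omega), h _ le_rfl⟩
      · rintro ⟨h, h'⟩ i hi
        rcases Nat.lt_or_ge k i with hk | hk
        · have : i = k + 1 := by omega
          rw [this, h']
        · exact h i hk
    rw [this, h1, ih x, Measure.smul_apply, Measure.smul_apply, h.2, smul_eq_mul, smul_eq_mul]
    ring

/-- The Markov property. -/
lemma IsMarkovChain.markov {ν P : Measure (ℕ → ℕ)} [IsProbabilityMeasure ν] [IsProbabilityMeasure P]
    {p : ℕ → ℕ → ℝ} {y0 y n : ℕ} (h : IsMarkovChain ν p y0) (hP : IsMarkovChain P p y)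
    {F : Set (ℕ → ℕ)} (hF : DepOn n F) (hy : ∀ ω ∈ F, ω n = y) {G : Set (ℕ → ℕ)}
    (hG : MeasurableSet G) :
    ν (F ∩ shiftP n ⁻¹' G) = ν F * P G := by
  have key : (ν.restrict F).map (shiftP n) = ν F • P := by
    refine hP.unique _ ?_ ?_ ?_
    · intro x hx
      rw [Measure.map_apply (measurable_shiftP n) (depOn_eval 0 0 le_rfl x).measurableSet,
        Measure.restrict_apply (measurable_shiftP n (depOn_eval 0 0 le_rfl x).measurableSet)]
      convert measure_empty (μ := ν)
      ext ω
      simp only [Set.mem_inter_iff, Set.mem_preimage, Set.mem_ofPred_eq, Set.mem_empty_iff_false,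
        iff_false, not_and]
      intro h1 h2
      have := hy ω h2
      simp only [shiftP, add_zero] at h1
      omega
    · rw [Measure.map_apply (measurable_shiftP n) MeasurableSet.univ]; simp
    · intro k x j
      have mA := (depOn_cyl k x).measurableSet
      have mB : MeasurableSet {ω : ℕ → ℕ | (∀ i ≤ k, ω i = x i) ∧ ω (k + 1) = j} :=
        mA.inter (depOn_eval (k + 1) (k + 1) le_rfl j).measurableSet
      rw [Measure.map_apply (measurable_shiftP n) mA, Measure.map_apply (measurable_shiftP n) mB,
        Measure.restrict_apply (measurable_shiftP n mA),
        Measure.restrict_apply (measurable_shiftP n mB)]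
      have hd : DepOn (n + k) (shiftP n ⁻¹' {ω | ∀ i ≤ k, ω i = x i} ∩ F) := by
        refine DepOn.inter ?_ (hF.mono (by omega))
        intro ω ω' h hω i hi
        simp only [shiftP]
        rw [← h (n + i) (by omega)]
        exact hω i hi
      rw [← h.step hd (y := x k) (fun ω hω => hω.1 k le_rfl) j]
      congr 1
      ext ω
      simp only [shiftP, Set.mem_inter_iff, Set.mem_preimage, Set.mem_ofPred_eq, add_assoc]
      tauto
  have := congrArg (fun m => m G) key
  simp only [Measure.smul_apply, smul_eq_mul] at this
  rw [← this, Measure.map_apply (measurable_shiftP n) hG,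
    Measure.restrict_apply (measurable_shiftP n hG), Set.inter_comm]

/-- Existence of the chain started from a reachable point. -/
lemma exists_chain {ν : Measure (ℕ → ℕ)} [IsProbabilityMeasure ν]
    {p : ℕ → ℕ → ℝ} {y0 y n : ℕ} (h : IsMarkovChain ν p y0)
    {F : Set (ℕ → ℕ)} (hF : DepOn n F) (hy : ∀ ω ∈ F, ω n = y) (hpos : ν F ≠ 0) :
    ∃ P : Measure (ℕ → ℕ), IsProbabilityMeasure P ∧ IsMarkovChain P p y := by
  have hft : ν F ≠ ∞ := measure_ne_top _ _
  refine ⟨(ν F)⁻¹ • (ν.restrict F).map (shiftP n), ⟨?_⟩, ?_, ?_⟩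
  · rw [Measure.smul_apply, Measure.map_apply (measurable_shiftP n) MeasurableSet.univ]
    simp [ENNReal.inv_mul_cancel hpos hft]
  · have m0 := (depOn_eval 0 0 le_rfl y).measurableSet
    rw [Measure.smul_apply, Measure.map_apply (measurable_shiftP n) m0,
      Measure.restrict_apply (measurable_shiftP n m0)]
    have : shiftP n ⁻¹' {ω | ω 0 = y} ∩ F = F := by
      refine Set.inter_eq_right.2 fun ω hω => ?_
      simpa [shiftP] using hy ω hω
    rw [this, smul_eq_mul, ENNReal.inv_mul_cancel hpos hft]
  · intro k x j
    have mA := (depOn_cyl k x).measurableSet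
    have mB : MeasurableSet {ω : ℕ → ℕ | (∀ i ≤ k, ω i = x i) ∧ ω (k + 1) = j} :=
      mA.inter (depOn_eval (k + 1) (k + 1) le_rfl j).measurableSet
    rw [Measure.smul_apply, Measure.smul_apply, 
      Measure.map_apply (measurable_shiftP n) mA, Measure.map_apply (measurable_shiftP n) mB,
      Measure.restrict_apply (measurable_shiftP n mA),
      Measure.restrict_apply (measurable_shiftP n mB)]
    have hd : DepOn (n + k) (shiftP n ⁻¹' {ω | ∀ i ≤ k, ω i = x i} ∩ F) := by
      refine DepOn.inter ?_ (hF.mono (by omega))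
      intro ω ω' h hω i hi
      simp only [shiftP]
      rw [← h (n + i) (by omega)]
      exact hω i hi
    have e := h.step hd (y := x k) (fun ω hω => hω.1 k le_rfl) j
    have e' : shiftP n ⁻¹' {ω | (∀ i ≤ k, ω i = x i) ∧ ω (k + 1) = j} ∩ F =
        shiftP n ⁻¹' {ω | ∀ i ≤ k, ω i = x i} ∩ F ∩ {ω | ω (n + k + 1) = j} := by
      ext ω
      simp only [shiftP, Set.mem_inter_iff, Set.mem_preimage, Set.mem_ofPred_eq, add_assoc]
      tauto
    rw [e', e, smul_eq_mul, smul_eq_mul]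
    ring

/-- `y` is reached with positive probability. -/
def ReachP (ν : Measure (ℕ → ℕ)) (y : ℕ) : Prop :=
  ∃ n F, DepOn n F ∧ (∀ ω ∈ F, ω n = y) ∧ ν F ≠ 0

lemma ReachP.next {ν : Measure (ℕ → ℕ)} {p : ℕ → ℕ → ℝ} {y0 y j : ℕ} (h : IsMarkovChain ν p y0)
    (hr : ReachP ν y) (hp : 0 < p y j) : ReachP ν j := by
  obtain ⟨n, F, hF, hy, hpos⟩ := hr
  refine ⟨n + 1, F ∩ {ω | ω (n + 1) = j}, (hF.mono (by omega)).inter (depOn_eval _ _ le_rfl _),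
    fun ω hω => hω.2, ?_⟩
  rw [h.step hF hy j]
  simp [hp, hpos]

lemma exists_family {μ : Measure (ℕ → ℕ)} [IsProbabilityMeasure μ] {q p1 p2 : ℕ → ℝ}
    (hq : ∀ k, 2 ≤ k → 0 < q k) 
    (hp2 : ∀ k, 2 ≤ k → 0 < p2 k)
    (hμ : IsMarkovChain μ (transX q p1 p2) 2) :
    ∃ P : ℕ → Measure (ℕ → ℕ), P 2 = μ ∧ (∀ y, IsProbabilityMeasure (P y)) ∧
      ∀ y, IsMarkovChain (P y) (transX q p1 p2) y := by
  have r2 : ReachP μ 2 := ⟨0, {ω | ω 0 = 2}, depOn_eval 0 0 le_rfl 2, fun ω h => h, by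
    rw [hμ.1]; exact one_ne_zero⟩
  have r0 : ReachP μ 0 := r2.next hμ (by simpa [transX] using hp2 2 le_rfl)
  have r1 : ReachP μ 1 := r0.next hμ (by simp [transX])
  have rr : ∀ y, 2 ≤ y → ReachP μ y := by
    intro y hy
    induction y, hy using Nat.le_induction with
    | base => exact r2
    | succ y hy ih =>
      refine ih.next hμ ?_
      have := hq y hy
      have h0 : y ≠ 0 := by omega
      have h1 : y ≠ 1 := by omega
      simpa [transX, h0, h1] using this
  have hall : ∀ y, ReachP μ y := by
    intro y
    rcases Nat.lt_or_ge y 2 with h | h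
    · interval_cases y
      · exact r0
      · exact r1
    · exact rr y h
  have hex : ∀ y, ∃ P : Measure (ℕ → ℕ), IsProbabilityMeasure P ∧ 
      IsMarkovChain P (transX q p1 p2) y := by
    intro y
    obtain ⟨n, F, hF, hy, hpos⟩ := hall y
    exact exists_chain hμ hF hy hpos
  choose P hP1 hP2 using hex
  refine ⟨Function.update P 2 μ, by simp, ?_, ?_⟩
  · intro y
    by_cases h : y = 2
    · subst h; simpa
    · simp only [Function.update_of_ne h]; exact hP1 y
  · intro y
    by_cases h : y = 2
    · subst h; simpa
    · simp only [Function.update_of_ne h]; exact hP2 y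

/-- The fundamental solution of the recursion, started at `j`. -/
def wfun (a b : ℕ → ℝ) (j : ℕ) : ℕ → ℝ
  | 0 => 1
  | 1 => a (j + 1)
  | (n + 2) => a (j + n + 2) * wfun a b j (n + 1) + b (j + n + 2) * wfun a b j n

def Sfun (a b : ℕ → ℝ) (j n : ℕ) : ℝ := ∑ t ∈ Finset.range n, wfun a b j t

/-- a level `≥ k` is reached before going strictly below `s`. -/
def Bset (s k : ℕ) : Set (ℕ → ℕ) := {ω | ∃ n, k ≤ ω n ∧ ∀ i ≤ n, s ≤ ω i}

/-- `n` is the first hitting time of `k`, and the path is below `k` before. -/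
def Tset (k n : ℕ) : Set (ℕ → ℕ) := {ω | ω n = k ∧ ∀ i < n, ω i < k}

def Kset (k : ℕ) : Set (ℕ → ℕ) := {ω | ∀ i, 1 ≤ i → k < ω i}

def Lset (k : ℕ) (G : Set (ℕ → ℕ)) : Set (ℕ → ℕ) := {ω | ∃ m, ω ∈ Tset k m ∧ shiftP m ω ∈ G}

def Aset (k : ℕ) : Set (ℕ → ℕ) := Lset k (Kset k)

def SkipFree (ω : ℕ → ℕ) : Prop := ∀ n, ω (n + 1) ≤ ω n + 1

lemma meas_le (k n : ℕ) : MeasurableSet {ω : ℕ → ℕ | k ≤ ω n} :=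
  measurableSet_le measurable_const (measurable_pi_apply n)

lemma meas_Bset (s k : ℕ) : MeasurableSet (Bset s k) := by
  have : Bset s k = ⋃ n, ({ω : ℕ → ℕ | k ≤ ω n} ∩ ⋂ i, ⋂ (_ : i ≤ n), {ω : ℕ → ℕ | s ≤ ω i}) := by
    ext ω; simp [Bset]
  rw [this]
  exact MeasurableSet.iUnion fun n => (meas_le _ _).inter
    (MeasurableSet.iInter fun i => MeasurableSet.iInter fun _ => meas_le _ _)

lemma depOn_Tset (k n : ℕ) : DepOn n (Tset k n) := by
  rintro ω ω' h ⟨h1, h2⟩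
  exact ⟨by rw [← h n le_rfl]; exact h1, fun i hi => by rw [← h i hi.le]; exact h2 i hi⟩

lemma meas_Kset (k : ℕ) : MeasurableSet (Kset k) := by
  have : Kset k = ⋂ i, ⋂ (_ : 1 ≤ i), {ω : ℕ → ℕ | k + 1 ≤ ω i} := by
    ext ω; simp [Kset, Nat.succ_le_iff]
  rw [this]
  exact MeasurableSet.iInter fun i => MeasurableSet.iInter fun _ => meas_le _ _

lemma Lset_eq (k : ℕ) (G : Set (ℕ → ℕ)) : Lset k G = ⋃ m, (Tset k m ∩ shiftP m ⁻¹' G) := by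
  ext ω; simp [Lset]

lemma meas_Lset (k : ℕ) {G : Set (ℕ → ℕ)} (hG : MeasurableSet G) : MeasurableSet (Lset k G) := by
  rw [Lset_eq]
  exact MeasurableSet.iUnion fun m => (depOn_Tset k m).measurableSet.inter (measurable_shiftP m hG)

lemma meas_Aset (k : ℕ) : MeasurableSet (Aset k) := meas_Lset k (meas_Kset k)

lemma Tset_unique {k m n : ℕ} {ω : ℕ → ℕ} (h : ω ∈ Tset k m) (h' : ω ∈ Tset k n) : m = n := by
  rcases lt_trichotomy m n with hl | hl | hl
  · have := h'.2 m hl; have := h.1; omega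
  · exact hl
  · have := h.2 n hl; have := h'.1; omega

lemma exists_Tset {ω : ℕ → ℕ} (hs : SkipFree ω) {k n : ℕ} (h0 : ω 0 ≤ k) (hn : k ≤ ω n) :
    ∃ m ≤ n, ω ∈ Tset k m := by
  classical
  have hex : ∃ m, k ≤ ω m := ⟨n, hn⟩
  refine ⟨Nat.find hex, Nat.find_min' hex hn, ?_, ?_⟩
  · have h1 := Nat.find_spec hex
    rcases Nat.eq_zero_or_pos (Nat.find hex) with h | h
    · rw [h] at h1 ⊢; omega
    · obtain ⟨m, hm⟩ := Nat.exists_eq_succ_of_ne_zero h.ne'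
      have h2 := Nat.find_min hex (m := m) (by omega)
      have h3 := hs m
      rw [hm] at h1 ⊢
      simp only [Nat.succ_eq_add_one] at *
      omega
  · intro i hi
    have := Nat.find_min hex hi
    omega

/-- After the first hitting time of `k`, the first hitting of `l > k` transfers. -/
lemma Tset_shift {k l m n : ℕ} {ω : ℕ → ℕ} (hkl : k < l) (h : ω ∈ Tset k m) :
    shiftP m ω ∈ Tset l n ↔ ω ∈ Tset l (m + n) := by
  constructor
  · rintro ⟨h1, h2⟩
    refine ⟨h1, fun i hi => ?_⟩
    rcases lt_trichotomy i m with h3 | h3 | h3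
    · have := h.2 i h3; omega
    · subst h3; have := h.1; omega
    · have := h2 (i - m) (by omega)
      simp only [shiftP] at this
      rwa [Nat.add_sub_cancel' h3.le] at this
  · rintro ⟨h1, h2⟩
    exact ⟨h1, fun i hi => h2 (m + i) (by omega)⟩

lemma Tset_lt {k l m n : ℕ} {ω : ℕ → ℕ} (hkl : k < l) (h : ω ∈ Tset k m) (h' : ω ∈ Tset l n) :
    m < n := by
  rcases lt_trichotomy m n with hl | hl | hl
  · exact hl
  · subst hl; have := h.1; have := h'.1; omega
  · have := h.2 n hl; have := h'.1; omega

lemma Lset_shift {k l m : ℕ} {ω : ℕ → ℕ} (hkl : k < l) (h : ω ∈ Tset k m) (G : Set (ℕ → ℕ)) :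
    shiftP m ω ∈ Lset l G ↔ ω ∈ Lset l G := by
  have e : ∀ n, shiftP n (shiftP m ω) = shiftP (m + n) ω := by
    intro n; funext i; simp [shiftP, add_assoc]
  constructor
  · rintro ⟨n, h1, h2⟩
    exact ⟨m + n, (Tset_shift hkl h).1 h1, by rw [← e]; exact h2⟩
  · rintro ⟨n, h1, h2⟩
    have := Tset_lt hkl h h1
    refine ⟨n - m, (Tset_shift hkl h).2 ?_, ?_⟩
    · rwa [Nat.add_sub_cancel' this.le]
    · rw [e, Nat.add_sub_cancel' this.le]; exact h2

/-- Cutpoints versus the sets `Aset`, deterministic part. -/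
lemma cut_iff {ω : ℕ → ℕ} (h0 : ω 0 = 2) (hs : SkipFree ω) (hu : ∀ k, ∃ n, k ≤ ω n) {k : ℕ}
    (hk : 2 ≤ k) :
    ω ∈ Aset k ↔ ∃! n, ω n = k := by
  have hu' : ∀ n, ω n < k → ∃ m, n ≤ m ∧ ω m = k := by
    intro n hn
    obtain ⟨m, hm⟩ := hu (k + ∑ i ∈ Finset.range (n + 1), ω i + 1)
    have hmn : n < m := by
      by_contra hc
      have : ω m ≤ ∑ i ∈ Finset.range (n + 1), ω i :=
        Finset.single_le_sum (f := ω) (fun i _ => Nat.zero_le _) (Finset.mem_range.2 (by omega))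
      omega
    have hs' : SkipFree (shiftP n ω) := fun i => hs (n + i)
    obtain ⟨l, -, hl⟩ := exists_Tset hs' (k := k) (n := m - n) (by simp only [shiftP, add_zero]; omega)
      (by simp only [shiftP]; rw [Nat.add_sub_cancel' hmn.le]; omega)
    exact ⟨n + l, by omega, hl.1⟩
  constructor
  · rintro ⟨m, h1, h2⟩
    refine ⟨m, h1.1, fun n hn => ?_⟩
    rcases lt_trichotomy m n with hl | hl | hl
    · have := h2 (n - m) (by omega)
      simp only [shiftP] at this
      rw [Nat.add_sub_cancel' hl.le] at this
      simp only at hn; omega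
    · exact hl.symm
    · have := h1.2 n hl; simp only at hn; omega
  · rintro ⟨m, h1, h2⟩
    obtain ⟨n, hn⟩ := hu k
    obtain ⟨m', -, hm'⟩ := exists_Tset hs (by omega) hn
    have e : m' = m := h2 m' hm'.1
    subst e
    refine ⟨m', hm', fun i hi => ?_⟩
    simp only [shiftP]
    by_contra hc
    push Not at hc
    rcases hc.lt_or_eq with hc | hc
    · obtain ⟨l, hl1, hl2⟩ := hu' _ hc
      have := h2 l hl2
      omega
    · have := h2 _ hc; omega

/-! ### Deterministic recursion -/

lemma wfun_unique {q p1 p2 : ℕ → ℝ} (hq : ∀ k, 2 ≤ k → 0 < q k) 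
    (hsum : ∀ k, 2 ≤ k → q k + p1 k + p2 k = 1) {j k : ℕ} (hj : 2 ≤ j) {u : ℕ → ℝ}
    (hz : ∀ y, y ≤ j → u y = 0)
    (hu : ∀ y, j < y → y < k → u y = q y * u (y + 1) + p1 y * u (y - 1) + p2 y * u (y - 2)) :
    ∀ n, j + n < k → u (j + n + 1) - u (j + n) = u (j + 1) * 
      wfun (fun k => (p1 k + p2 k) / q k) (fun k => p2 k / q k) j n := by
  intro n
  induction n using Nat.twoStepInduction with
  | zero => intro _; simp [wfun, hz j le_rfl]
  | one =>
    intro hk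
    have h1 := hu (j + 1) (by omega) (by omega)
    have e1 : j + 1 - 1 = j := by omega
    have e2 : j + 1 - 2 = j - 1 := by omega
    rw [e1, e2, hz j le_rfl, hz (j - 1) (by omega)] at h1
    have h2 := hsum (j + 1) (by omega)
    have h3 := hq (j + 1) (by omega)
    simp only [wfun]
    field_simp
    have : p1 (j + 1) + p2 (j + 1) = 1 - q (j + 1) := by linarith
    rw [this]
    linarith
  | more n ih1 ih2 =>
    intro hk
    have i1 := ih1 (by omega)
    have i2 := ih2 (by omega)
    have h1 := hu (j + n + 2) (by omega) (by omega)
    have e1 : j + n + 2 - 1 = j + n + 1 := by omega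
    have e2 : j + n + 2 - 2 = j + n := by omega
    rw [e1, e2] at h1
    have h2 := hsum (j + n + 2) (by omega)
    have h3 := hq (j + n + 2) (by omega)
    have e3 : j + (n + 1) = j + n + 1 := by omega
    have e4 : j + (n + 2) = j + n + 2 := by omega
    have e5 : j + n + 1 + 1 = j + n + 2 := by omega
    rw [e3, e5] at i2
    rw [e4]
    simp only [wfun]
    have : u (j + n + 2 + 1) - u (j + n + 2) =
        (p1 (j + n + 2) + p2 (j + n + 2)) / q (j + n + 2) * (u (j + n + 2) - u (j + n + 1)) +
        p2 (j + n + 2) / q (j + n + 2) * (u (j + n + 1) - u (j + n)) := by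
      field_simp
      have e : p1 (j + n + 2) = 1 - q (j + n + 2) - p2 (j + n + 2) := by linarith
      rw [e] at h1 ⊢
      linear_combination -h1
    rw [this, i1, i2]
    ring

lemma Sfun_unique {q p1 p2 : ℕ → ℝ} (hq : ∀ k, 2 ≤ k → 0 < q k) 
    (hsum : ∀ k, 2 ≤ k → q k + p1 k + p2 k = 1) {j k : ℕ} (hj : 2 ≤ j) {u : ℕ → ℝ}
    (hz : ∀ y, y ≤ j → u y = 0)
    (hu : ∀ y, j < y → y < k → u y = q y * u (y + 1) + p1 y * u (y - 1) + p2 y * u (y - 2)) :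
    ∀ n, j + n ≤ k → u (j + n) = u (j + 1) *
      Sfun (fun k => (p1 k + p2 k) / q k) (fun k => p2 k / q k) j n := by
  intro n
  induction n with
  | zero => intro _; simp [Sfun, hz j le_rfl]
  | succ n ih =>
    intro hk
    have := wfun_unique hq hsum hj hz hu n (by omega)
    have ih' := ih (by omega)
    rw [Sfun, Finset.sum_range_succ, mul_add, ← this]
    rw [Sfun] at ih'
    rw [← ih', ← add_assoc]; ring

lemma const_unique {q p1 p2 : ℕ → ℝ} (hq : ∀ k, 2 ≤ k → 0 < q k) 
    (hsum : ∀ k, 2 ≤ k → q k + p1 k + p2 k = 1) {k : ℕ} {u : ℕ → ℝ}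
    (h0 : u 0 = u 1) (h1 : u 1 = u 2)
    (hu : ∀ y, 2 ≤ y → y < k → u y = q y * u (y + 1) + p1 y * u (y - 1) + p2 y * u (y - 2)) :
    ∀ n, n ≤ k → u n = u 0 := by
  intro n
  induction n using Nat.strong_induction_on with
  | _ n ih =>
    intro hk
    rcases Nat.lt_or_ge n 3 with hn | hn
    · interval_cases n
      · rfl
      · exact h0.symm
      · rw [← h1, ← h0]
    · have e := hu (n - 1) (by omega) (by omega)
      have e1 : n - 1 + 1 = n := by omega
      rw [e1, ih (n - 1) (by omega) (by omega), ih (n - 1 - 1) (by omega) (by omega),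
        ih (n - 1 - 2) (by omega) (by omega)] at e
      have h2 := hsum (n - 1) (by omega)
      have h3 := hq (n - 1) (by omega)
      have : q (n - 1) * (u n - u 0) = 0 := by
        linear_combination -e - u 0 * h2
      rcases mul_eq_zero.1 this with h | h
      · linarith
      · linarith

lemma prob_eq_one_iff_ae {ν : Measure (ℕ → ℕ)} [IsProbabilityMeasure ν] {s : Set (ℕ → ℕ)}
    (hs : MeasurableSet s) : ν s = 1 ↔ ∀ᵐ ω ∂ν, ω ∈ s :=
  (mem_ae_iff_prob_eq_one hs).symm

section Family

variable {q p1 p2 : ℕ → ℝ} {P : ℕ → Measure (ℕ → ℕ)}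

lemma ae_zero (hpr : ∀ y, IsProbabilityMeasure (P y))
    (hP : ∀ y, IsMarkovChain (P y) (transX q p1 p2) y) (y : ℕ) : ∀ᵐ ω ∂(P y), ω 0 = y := by
  have m0 := (depOn_eval 0 0 le_rfl y).measurableSet
  rw [ae_iff]
  have := hpr y
  exact (prob_compl_eq_zero_iff m0).2 (hP y).1

lemma transX_up {n j : ℕ} (h : n + 1 < j) : transX q p1 p2 n j = 0 := by
  unfold transX
  split_ifs <;> first | rfl | omega

lemma ae_skipFree (hP : ∀ y, IsMarkovChain (P y) (transX q p1 p2) y) (y : ℕ) :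
    ∀ᵐ ω ∂(P y), SkipFree ω := by
  unfold SkipFree
  rw [ae_all_iff]
  intro n
  rw [ae_iff]
  have : {ω : ℕ → ℕ | ¬ ω (n + 1) ≤ ω n + 1} ⊆
      ⋃ z, ⋃ j, ⋃ (_ : z + 1 < j), ({ω : ℕ → ℕ | ω n = z} ∩ {ω | ω (n + 1) = j}) := by
    intro ω hω
    simp only [Set.mem_ofPred_eq, not_le] at hω
    simp [hω]
  refine measure_mono_null this ?_
  refine measure_iUnion_null fun z => measure_iUnion_null fun j => measure_iUnion_null fun h => ?_
  rw [(hP y).step (depOn_eval n n le_rfl z) (fun ω h => h), transX_up h]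
  simp

lemma first_step_tsum (hpr : ∀ y, IsProbabilityMeasure (P y))
    (hP : ∀ y, IsMarkovChain (P y) (transX q p1 p2) y) (y : ℕ) {G : Set (ℕ → ℕ)}
    (hG : MeasurableSet G) :
    P y (shiftP 1 ⁻¹' G) = ∑' j, ENNReal.ofReal (transX q p1 p2 y j) * P j G := by
  have := hpr y
  have hm := measurable_shiftP 1 hG
  have mE : ∀ j, MeasurableSet ({ω : ℕ → ℕ | ω 0 = y} ∩ {ω | ω (0 + 1) = j}) := fun j =>
    (depOn_eval 0 0 le_rfl y).measurableSet.inter (depOn_eval 1 1 le_rfl j).measurableSet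
  have e1 : P y (shiftP 1 ⁻¹' G) =
      P y (⋃ j, ({ω : ℕ → ℕ | ω 0 = y} ∩ {ω | ω (0 + 1) = j}) ∩ shiftP 1 ⁻¹' G) := by
    refine measure_congr ?_
    filter_upwards [ae_zero hpr hP y] with ω hω
    apply propext
    change ω ∈ shiftP 1 ⁻¹' G ↔ ω ∈ ⋃ j, ({ω : ℕ → ℕ | ω 0 = y} ∩ {ω | ω (0 + 1) = j}) ∩ shiftP 1 ⁻¹' G
    simp [hω]
  rw [e1, measure_iUnion]
  · congr 1
    funext j
    have := hpr j
    rw [(hP y).markov (hP j) (n := 1)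
      (((depOn_eval 0 0 le_rfl y).mono (by omega)).inter (depOn_eval 1 1 le_rfl j))
      (fun ω h => h.2) hG, (hP y).step (depOn_eval 0 0 le_rfl y) (fun ω h => h), (hP y).1, mul_one]
  · intro i j hij
    refine Set.disjoint_left.2 fun ω h1 h2 => hij ?_
    have a1 : ω (0 + 1) = i := h1.1.2
    have a2 : ω (0 + 1) = j := h2.1.2
    rw [← a1, a2]
  · exact fun j => (mE j).inter hm

lemma first_step (hq : ∀ k, 2 ≤ k → 0 < q k) (hp1 : ∀ k, 2 ≤ k → 0 ≤ p1 k)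
    (hp2 : ∀ k, 2 ≤ k → 0 < p2 k) (hpr : ∀ y, IsProbabilityMeasure (P y))
    (hP : ∀ y, IsMarkovChain (P y) (transX q p1 p2) y) {y : ℕ} (hy : 2 ≤ y) {G : Set (ℕ → ℕ)}
    (hG : MeasurableSet G) :
    (P y).real (shiftP 1 ⁻¹' G) = q y * (P (y + 1)).real G + p1 y * (P (y - 1)).real G
      + p2 y * (P (y - 2)).real G := by
  have h0 : y ≠ 0 := by omega
  have h1 : y ≠ 1 := by omega
  have e := first_step_tsum hpr hP y hG
  have t1 : transX q p1 p2 y (y + 1) = q y := by simp [transX, h0, h1]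
  have t2 : transX q p1 p2 y (y - 1) = p1 y := by
    have : y - 1 ≠ y + 1 := by omega
    simp [transX, h0, h1, this]
  have t3 : transX q p1 p2 y (y - 2) = p2 y := by
    have : y - 2 ≠ y + 1 := by omega
    have : y - 2 ≠ y - 1 := by omega
    simp [transX, h0, h1, *]
  have t4 : ∀ j ∉ ({y + 1, y - 1, y - 2} : Finset ℕ), 
      ENNReal.ofReal (transX q p1 p2 y j) * P j G = 0 := by
    intro j hj
    simp only [Finset.mem_insert, Finset.mem_singleton, not_or] at hj
    simp [transX, h0, h1, hj.1, hj.2.1, hj.2.2]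
  rw [tsum_eq_sum t4, Finset.sum_insert (by simp; omega), Finset.sum_insert (by simp; omega),
    Finset.sum_singleton, t1, t2, t3] at e
  have f := fun z => measure_ne_top (P z) G
  rw [measureReal_def, e, ENNReal.toReal_add, ENNReal.toReal_add, ENNReal.toReal_mul,
    ENNReal.toReal_mul, ENNReal.toReal_mul, ENNReal.toReal_ofReal (hq y hy).le,
    ENNReal.toReal_ofReal (hp1 y hy), ENNReal.toReal_ofReal (hp2 y hy).le]
  · simp only [measureReal_def]; ring
  all_goals
    have := hpr (y + 1); have := hpr (y - 1); have := hpr (y - 2)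
    finiteness

lemma first_step_small (hpr : ∀ y, IsProbabilityMeasure (P y))
    (hP : ∀ y, IsMarkovChain (P y) (transX q p1 p2) y) {y : ℕ} (hy : y < 2) {G : Set (ℕ → ℕ)}
    (hG : MeasurableSet G) :
    (P y).real (shiftP 1 ⁻¹' G) = (P (y + 1)).real G := by
  have e := first_step_tsum hpr hP y hG
  rw [measureReal_def, measureReal_def, e, tsum_eq_single (y + 1)]
  · congr 1
    interval_cases y <;> simp [transX]
  · intro j hj
    interval_cases y
    · have : j ≠ 1 := by omega
      simp [transX, this]
    · have : j ≠ 2 := by omega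
      simp [transX, this]

lemma Bset_zero (hpr : ∀ y, IsProbabilityMeasure (P y))
    (hP : ∀ y, IsMarkovChain (P y) (transX q p1 p2) y) {s k y : ℕ} (hy : y < s) :
    (P y).real (Bset s k) = 0 := by
  rw [measureReal_def]
  have : P y (Bset s k) = 0 := by
    have h0 := ae_zero hpr hP y
    rw [ae_iff] at h0
    refine measure_mono_null ?_ h0
    rintro ω ⟨n, h1, h2⟩
    have := h2 0 (Nat.zero_le _)
    simp only [Set.mem_ofPred_eq]; omega
  simp [this]

lemma Bset_one (hpr : ∀ y, IsProbabilityMeasure (P y))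
    (hP : ∀ y, IsMarkovChain (P y) (transX q p1 p2) y) {s k y : ℕ} (hy : s ≤ y) (hk : k ≤ y) :
    (P y).real (Bset s k) = 1 := by
  rw [measureReal_def]
  have := hpr y
  have : P y (Bset s k) = 1 := by
    rw [prob_eq_one_iff_ae]
    · filter_upwards [ae_zero hpr hP y] with ω hω
      refine ⟨0, by omega, fun i hi => ?_⟩
      have : i = 0 := by omega
      subst this; omega
    · exact meas_Bset s k
  simp [this]

lemma Bset_shift (hpr : ∀ y, IsProbabilityMeasure (P y))
    (hP : ∀ y, IsMarkovChain (P y) (transX q p1 p2) y) {s k y : ℕ} (hy : s ≤ y) (hk : y < k) :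
    (P y).real (Bset s k) = (P y).real (shiftP 1 ⁻¹' (Bset s k)) := by
  refine measureReal_congr ?_
  filter_upwards [ae_zero hpr hP y] with ω hω
  apply propext
  change ω ∈ Bset s k ↔ ω ∈ shiftP 1 ⁻¹' (Bset s k)
  constructor
  · rintro ⟨n, h1, h2⟩
    have hn : n ≠ 0 := by rintro rfl; omega
    refine ⟨n - 1, ?_, fun i hi => h2 _ (by omega)⟩
    simp only [shiftP]
    rwa [Nat.add_sub_cancel' (by omega)]
  · rintro ⟨n, h1, h2⟩
    refine ⟨1 + n, h1, fun i hi => ?_⟩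
    rcases Nat.eq_zero_or_pos i with h | h
    · subst h; omega
    · have := h2 (i - 1) (by omega)
      simp only [shiftP] at this
      rwa [Nat.add_sub_cancel' (by omega)] at this

lemma hit_one (hq : ∀ k, 2 ≤ k → 0 < q k) (hp1 : ∀ k, 2 ≤ k → 0 ≤ p1 k)
    (hp2 : ∀ k, 2 ≤ k → 0 < p2 k) (hsum : ∀ k, 2 ≤ k → q k + p1 k + p2 k = 1)
    (hpr : ∀ y, IsProbabilityMeasure (P y))
    (hP : ∀ y, IsMarkovChain (P y) (transX q p1 p2) y) {y k : ℕ} (hk : 2 ≤ k) :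
    (P y).real (Bset 0 k) = 1 := by
  rcases le_total k y with h | hyk
  · exact Bset_one hpr hP (Nat.zero_le _) h
  have hc := const_unique (u := fun y => (P y).real (Bset 0 k)) (k := k) hq hsum ?_ ?_ ?_
  · have e1 := hc y hyk
    have e2 := hc k le_rfl
    rw [e1, ← e2]
    exact Bset_one hpr hP (Nat.zero_le _) le_rfl
  · rw [Bset_shift hpr hP (Nat.zero_le _) (by omega : 0 < k)]
    exact first_step_small hpr hP (by omega) (meas_Bset _ _)
  · rw [Bset_shift hpr hP (Nat.zero_le _) (by omega : 1 < k)]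
    exact first_step_small hpr hP (by omega) (meas_Bset _ _)
  · intro y hy hyk
    rw [Bset_shift hpr hP (Nat.zero_le _) hyk]
    exact first_step hq hp1 hp2 hpr hP hy (meas_Bset _ _)

lemma ruin (hq : ∀ k, 2 ≤ k → 0 < q k) (hp1 : ∀ k, 2 ≤ k → 0 ≤ p1 k)
    (hp2 : ∀ k, 2 ≤ k → 0 < p2 k) (hsum : ∀ k, 2 ≤ k → q k + p1 k + p2 k = 1)
    (hpr : ∀ y, IsProbabilityMeasure (P y))
    (hP : ∀ y, IsMarkovChain (P y) (transX q p1 p2) y) {j n : ℕ} (hj : 2 ≤ j) (hn : 1 ≤ n) :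
    (P j).real (shiftP 1 ⁻¹' (Bset (j + 1) (j + n))) =
      q j / Sfun (fun k => (p1 k + p2 k) / q k) (fun k => p2 k / q k) j n := by
  rw [first_step hq hp1 hp2 hpr hP hj (meas_Bset _ _), 
    Bset_zero hpr hP (by omega : j - 1 < j + 1), Bset_zero hpr hP (by omega : j - 2 < j + 1)]
  have hs := Sfun_unique (u := fun y => (P y).real (Bset (j + 1) (j + n))) (k := j + n) 
    hq hsum hj ?_ ?_ n le_rfl
  · rw [Bset_one hpr hP (by omega) le_rfl] at hs
    have : (P (j + 1)).real (Bset (j + 1) (j + n)) = 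
       1 / Sfun (fun k => (p1 k + p2 k) / q k) (fun k => p2 k / q k) j n :=
       eq_one_div_of_mul_eq_one_left hs.symm
    rw [this]; ring
  · intro y hy
    exact Bset_zero hpr hP (by omega)
  · intro y hy hy'
    rw [Bset_shift hpr hP (by omega) hy']
    exact first_step hq hp1 hp2 hpr hP (by omega) (meas_Bset _ _)

/-- almost sure properties of paths -/
lemma ae_good (hq : ∀ k, 2 ≤ k → 0 < q k) (hp1 : ∀ k, 2 ≤ k → 0 ≤ p1 k)
    (hp2 : ∀ k, 2 ≤ k → 0 < p2 k) (hsum : ∀ k, 2 ≤ k → q k + p1 k + p2 k = 1)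
    (hpr : ∀ y, IsProbabilityMeasure (P y))
    (hP : ∀ y, IsMarkovChain (P y) (transX q p1 p2) y) (y : ℕ) :
    ∀ᵐ ω ∂(P y), ω 0 = y ∧ SkipFree ω ∧ ∀ k, ∃ n, k ≤ ω n := by
  have h3 : ∀ᵐ ω ∂(P y), ∀ k, ω ∈ Bset 0 (k + 2) := by
    rw [ae_all_iff]
    intro k
    have := hpr y
    rw [← prob_eq_one_iff_ae (meas_Bset _ _)]
    have := hit_one hq hp1 hp2 hsum hpr hP (y := y) (by omega : 2 ≤ k + 2)
    rw [measureReal_def] at this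
    rw [← ENNReal.toReal_eq_one_iff]
    exact this
  filter_upwards [ae_zero hpr hP y, ae_skipFree hP y, h3] with ω h0 h1 h2
  refine ⟨h0, h1, fun k => ?_⟩
  obtain ⟨n, hn, -⟩ := h2 k
  exact ⟨n, by omega⟩

/-- The strong Markov property at first hitting times. -/
lemma strong_markov (hpr : ∀ y, IsProbabilityMeasure (P y))
    (hP : ∀ y, IsMarkovChain (P y) (transX q p1 p2) y) (y k : ℕ) {F : ℕ → Set (ℕ → ℕ)}
    (hF : ∀ m, DepOn m (F m)) (hFT : ∀ m, F m ⊆ Tset k m) {G : Set (ℕ → ℕ)}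
    (hG : MeasurableSet G) :
    P y (⋃ m, F m ∩ shiftP m ⁻¹' G) = P y (⋃ m, F m) * P k G := by
  have := hpr y
  have := hpr k
  have hd : Pairwise (Function.onFun Disjoint F) := by
    intro i j hij
    exact Set.disjoint_left.2 fun ω h1 h2 => hij (Tset_unique (hFT i h1) (hFT j h2))
  rw [measure_iUnion, measure_iUnion hd fun m => (hF m).measurableSet, ← ENNReal.tsum_mul_right]
  · congr 1
    funext m
    exact (hP y).markov (hP k) (hF m) (fun ω hω => (hFT m hω).1) hG
  · intro i j hij
    exact (hd hij).mono Set.inter_subset_left Set.inter_subset_left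
  · exact fun m => (hF m).measurableSet.inter (measurable_shiftP m hG)

lemma prob_Lset (hq : ∀ k, 2 ≤ k → 0 < q k) (hp1 : ∀ k, 2 ≤ k → 0 ≤ p1 k)
    (hp2 : ∀ k, 2 ≤ k → 0 < p2 k) (hsum : ∀ k, 2 ≤ k → q k + p1 k + p2 k = 1)
    (hpr : ∀ y, IsProbabilityMeasure (P y))
    (hP : ∀ y, IsMarkovChain (P y) (transX q p1 p2) y) {k : ℕ} (hk : 2 ≤ k) {G : Set (ℕ → ℕ)}
    (hG : MeasurableSet G) : P 2 (Lset k G) = P k G := by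
  have := hpr 2
  rw [Lset_eq, strong_markov hpr hP 2 k (depOn_Tset k) (fun m => le_rfl) hG]
  have : P 2 (⋃ m, Tset k m) = 1 := by
    rw [prob_eq_one_iff_ae (MeasurableSet.iUnion fun m => (depOn_Tset k m).measurableSet)]
    filter_upwards [ae_good hq hp1 hp2 hsum hpr hP 2] with ω ⟨h0, h1, h2⟩
    obtain ⟨n, hn⟩ := h2 k
    obtain ⟨m, -, hm⟩ := exists_Tset h1 (by omega) hn
    exact Set.mem_iUnion.2 ⟨m, hm⟩
  rw [this, one_mul]

lemma prob_Aset_Lset (hq : ∀ k, 2 ≤ k → 0 < q k) (hp1 : ∀ k, 2 ≤ k → 0 ≤ p1 k)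
    (hp2 : ∀ k, 2 ≤ k → 0 < p2 k) (hsum : ∀ k, 2 ≤ k → q k + p1 k + p2 k = 1)
    (hpr : ∀ y, IsProbabilityMeasure (P y))
    (hP : ∀ y, IsMarkovChain (P y) (transX q p1 p2) y) {j k : ℕ} (hj : 2 ≤ j) (hjk : j < k)
    {G : Set (ℕ → ℕ)} (hG : MeasurableSet G) (hGK : G ⊆ Kset k) :
    P 2 (Aset j ∩ Lset k G) = P j (shiftP 1 ⁻¹' (Bset (j + 1) k)) * P 2 (Lset k G) := by
  set F : ℕ → Set (ℕ → ℕ) := fun m => Tset k m ∩ 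
    {ω | ∃ n < m, ω ∈ Tset j n ∧ ∀ i, n < i → i ≤ m → j < ω i} with hFdef
  have hF : ∀ m, DepOn m (F m) := by
    intro m
    refine (depOn_Tset k m).inter ?_
    rintro ω ω' h ⟨n, hn, h1, h2⟩
    refine ⟨n, hn, depOn_Tset j n ω ω' (fun i hi => h i (by omega)) h1, fun i h3 h4 => ?_⟩
    rw [← h i h4]; exact h2 i h3 h4
  have hFT : ∀ m, F m ⊆ Tset k m := fun m => Set.inter_subset_left
  have e1 : Aset j ∩ Lset k G = ⋃ m, F m ∩ shiftP m ⁻¹' G := by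
    ext ω
    simp only [Set.mem_inter_iff, Set.mem_iUnion]
    constructor
    · rintro ⟨⟨n, h1, h2⟩, ⟨m, h3, h4⟩⟩
      have hnm := Tset_lt hjk h1 h3
      refine ⟨m, ⟨h3, n, hnm, h1, fun i h5 h6 => ?_⟩, h4⟩
      have := h2 (i - n) (by omega)
      simp only [shiftP] at this
      rwa [Nat.add_sub_cancel' h5.le] at this
    · rintro ⟨m, ⟨h3, n, hnm, h1, h5⟩, h4⟩
      refine ⟨⟨n, h1, fun i hi => ?_⟩, m, h3, h4⟩
      simp only [shiftP]
      rcases Nat.lt_or_ge m (n + i) with h6 | h6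
      · have := hGK h4 (n + i - m) (by omega)
        simp only [shiftP] at this
        rw [Nat.add_sub_cancel' h6.le] at this
        omega
      · exact h5 _ (by omega) h6
  rw [e1, strong_markov hpr hP 2 k hF hFT hG, prob_Lset hq hp1 hp2 hsum hpr hP (by omega) hG]
  congr 1
  rw [← prob_Lset hq hp1 hp2 hsum hpr hP hj (measurable_shiftP 1 (meas_Bset (j + 1) k))]
  refine measure_congr ?_
  filter_upwards [ae_good hq hp1 hp2 hsum hpr hP 2] with ω ⟨h0, hs, hu⟩
  apply propext
  change (ω ∈ ⋃ m, F m) ↔ ω ∈ Lset j (shiftP 1 ⁻¹' Bset (j + 1) k)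
  constructor
  · intro h
    obtain ⟨m, h3, n, hnm, h1, h5⟩ := Set.mem_iUnion.1 h
    refine ⟨n, h1, m - n - 1, ?_, ?_⟩
    · simp only [shiftP]
      have : n + (1 + (m - n - 1)) = m := by omega
      rw [this, h3.1]
    · intro i hi
      exact h5 _ (by omega) (by omega)
  · rintro ⟨n, h1, t, h2, h3⟩
    obtain ⟨m, hm1, hm2⟩ := exists_Tset hs (k := k) (by omega) h2
    refine Set.mem_iUnion.2 ⟨m, hm2, n, Tset_lt hjk h1 hm2, h1, fun i h4 h5 => ?_⟩
    have := h3 (i - n - 1) (by omega)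
    simp only [shiftP] at this
    have e : n + (1 + (i - n - 1)) = i := by omega
    rw [e] at this
    omega

lemma prob_Kset_le (hq : ∀ k, 2 ≤ k → 0 < q k) (hp1 : ∀ k, 2 ≤ k → 0 ≤ p1 k)
    (hp2 : ∀ k, 2 ≤ k → 0 < p2 k) (hsum : ∀ k, 2 ≤ k → q k + p1 k + p2 k = 1)
    (hpr : ∀ y, IsProbabilityMeasure (P y))
    (hP : ∀ y, IsMarkovChain (P y) (transX q p1 p2) y) (k M : ℕ) :
    P k (Kset k) ≤ P k (shiftP 1 ⁻¹' (Bset (k + 1) M)) := by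
  refine measure_mono_ae ?_
  filter_upwards [ae_good hq hp1 hp2 hsum hpr hP k] with ω ⟨h0, hs, hu⟩ hK
  obtain ⟨n, hn⟩ := hu (max M (k + 1))
  have hn0 : n ≠ 0 := by
    rintro rfl
    have := le_max_right M (k + 1)
    omega
  refine ⟨n - 1, ?_, fun i hi => hK _ (by omega)⟩
  simp only [shiftP]
  rw [Nat.add_sub_cancel' (by omega)]
  exact (le_max_left _ _).trans hn

lemma prob_Kset_ge (hpr : ∀ y, IsProbabilityMeasure (P y)) (k : ℕ) {c : ℝ≥0∞}
    (hc : ∀ n, 1 ≤ n → c ≤ P k (shiftP 1 ⁻¹' (Bset (k + 1) (k + n)))) :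
    c ≤ P k (Kset k) := by
  have := hpr k
  have hsub : (⋂ n : ℕ, shiftP 1 ⁻¹' (Bset (k + 1) (k + (n + 1)))) ⊆ Kset k := by
    intro ω hω i hi
    have := Set.mem_iInter.1 hω (∑ l ∈ Finset.range (i + 1), ω l)
    obtain ⟨n, h1, h2⟩ := this
    have hin : i < 1 + n := by
      by_contra hcon
      have : ω (1 + n) ≤ ∑ i ∈ Finset.range (i + 1), ω i :=
        Finset.single_le_sum (f := ω) (fun i _ => Nat.zero_le _) (Finset.mem_range.2 (by omega))
      simp only [shiftP] at h1
      omega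
    have := h2 (i - 1) (by omega)
    simp only [shiftP] at this
    rw [Nat.add_sub_cancel' hi] at this
    omega
  refine le_trans ?_ (measure_mono hsub)
  have hanti : Antitone fun n : ℕ => shiftP 1 ⁻¹' (Bset (k + 1) (k + (n + 1))) := by
    intro m n hmn ω hω
    obtain ⟨t, h1, h2⟩ := hω
    exact ⟨t, by omega, h2⟩
  have ht := tendsto_measure_iInter_atTop (μ := P k) (s := fun n : ℕ => shiftP 1 ⁻¹' (Bset (k + 1) (k + (n + 1))))
    (fun n => (measurable_shiftP 1 (meas_Bset _ _)).nullMeasurableSet) hanti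
    ⟨0, measure_ne_top _ _⟩
  exact ge_of_tendsto' ht fun n => hc _ (by omega)

/-- zero-one law -/
lemma zero_one (hq : ∀ k, 2 ≤ k → 0 < q k) (hp1 : ∀ k, 2 ≤ k → 0 ≤ p1 k)
    (hp2 : ∀ k, 2 ≤ k → 0 < p2 k) (hsum : ∀ k, 2 ≤ k → q k + p1 k + p2 k = 1)
    (hpr : ∀ y, IsProbabilityMeasure (P y))
    (hP : ∀ y, IsMarkovChain (P y) (transX q p1 p2) y) {I : Set (ℕ → ℕ)} (hI : MeasurableSet I)
    (hinv : ∀ k m ω, ω ∈ Tset k m → (shiftP m ω ∈ I ↔ ω ∈ I)) : P 2 I = 0 ∨ P 2 I = 1 := by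
  have := hpr 2
  have hcyl : ∀ (k : ℕ) (x : ℕ → ℕ), P 2 (I ∩ {ω | ∀ i ≤ k, ω i = x i}) =
      P 2 I * P 2 {ω | ∀ i ≤ k, ω i = x i} := by
    intro k x
    set M := ∑ i ∈ Finset.range (k + 1), x i + 2 with hM
    have hxM : ∀ i ≤ k, x i < M := by
      intro i hi
      have : x i ≤ ∑ i ∈ Finset.range (k + 1), x i :=
        Finset.single_le_sum (f := x) (fun i _ => Nat.zero_le _) (Finset.mem_range.2 (by omega))
      omega
    have hTm : ∀ᵐ ω ∂(P 2), ∃ m, ω ∈ Tset M m := by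
      filter_upwards [ae_good hq hp1 hp2 hsum hpr hP 2] with ω ⟨h0, h1, h2⟩
      obtain ⟨n, hn⟩ := h2 M
      obtain ⟨m, -, hm⟩ := exists_Tset h1 (by omega) hn
      exact ⟨m, hm⟩
    have eI : P 2 I = P M I := by
      rw [← prob_Lset hq hp1 hp2 hsum hpr hP (by omega : 2 ≤ M) hI]
      refine measure_congr ?_
      filter_upwards [hTm] with ω ⟨m, hm⟩
      apply propext
      change ω ∈ I ↔ ω ∈ Lset M I
      constructor
      · intro h; exact ⟨m, hm, (hinv _ _ _ hm).2 h⟩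
      · rintro ⟨m', hm', h⟩; exact (hinv _ _ _ hm').1 h
    set F : ℕ → Set (ℕ → ℕ) := fun m => Tset M m ∩ {ω | k < m ∧ ∀ i ≤ k, ω i = x i} with hFdef
    have hF : ∀ m, DepOn m (F m) := by
      intro m
      refine (depOn_Tset M m).inter ?_
      rintro ω ω' h ⟨h1, h2⟩
      exact ⟨h1, fun i hi => by rw [← h i (by omega)]; exact h2 i hi⟩
    have hsm := strong_markov hpr hP 2 M hF (fun m => Set.inter_subset_left) hI
    have hmem : ∀ ω m, ω ∈ Tset M m → (∀ i ≤ k, ω i = x i) → ω ∈ F m := by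
      intro ω m hm hx
      refine ⟨hm, ?_, hx⟩
      by_contra hc
      have h1 := hxM m (by omega)
      rw [← hx m (by omega), hm.1] at h1
      omega
    have e1 : P 2 (I ∩ {ω | ∀ i ≤ k, ω i = x i}) = P 2 (⋃ m, F m ∩ shiftP m ⁻¹' I) := by
      refine measure_congr ?_
      filter_upwards [hTm] with ω ⟨m, hm⟩
      apply propext
      change ω ∈ I ∩ {ω | ∀ i ≤ k, ω i = x i} ↔ ω ∈ ⋃ m, F m ∩ shiftP m ⁻¹' I
      constructor
      · rintro ⟨h1, h2⟩
        exact Set.mem_iUnion.2 ⟨m, hmem ω m hm h2, (hinv _ _ _ hm).2 h1⟩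
      · intro h
        obtain ⟨m', h1, h2⟩ := Set.mem_iUnion.1 h
        exact ⟨(hinv _ _ _ h1.1).1 h2, h1.2.2⟩
    have e2 : P 2 {ω | ∀ i ≤ k, ω i = x i} = P 2 (⋃ m, F m) := by
      refine measure_congr ?_
      filter_upwards [hTm] with ω ⟨m, hm⟩
      apply propext
      change ω ∈ {ω : ℕ → ℕ | ∀ i ≤ k, ω i = x i} ↔ ω ∈ ⋃ m, F m
      constructor
      · intro h2
        exact Set.mem_iUnion.2 ⟨m, hmem ω m hm h2⟩
      · intro h
        obtain ⟨m', h1⟩ := Set.mem_iUnion.1 h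
        exact h1.2.2
    rw [e1, e2, hsm, eI, mul_comm]
  have key : (P 2).restrict I = P 2 I • P 2 := by
    refine ext_cyl _ _ ?_ (by simp)
    intro k x
    rw [Measure.restrict_apply (depOn_cyl k x).measurableSet, Set.inter_comm, hcyl]
    rfl
  have h := congrArg (fun m => m I) key
  simp only [Measure.restrict_apply hI, Set.inter_self, Measure.smul_apply, smul_eq_mul] at h
  by_cases h0 : P 2 I = 0
  · exact Or.inl h0
  · right
    have := (ENNReal.mul_right_inj h0 (measure_ne_top (P 2) I) (b := 1) (c := P 2 I)).1 (by rw [mul_one]; exact h)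
    exact this.symm

end Family

lemma wfun_pos {a b : ℕ → ℝ} {j : ℕ} (ha : ∀ k, j < k → 0 < a k) (hb : ∀ k, j < k → 0 < b k) :
    ∀ n, 0 < wfun a b j n := by
  intro n
  induction n using Nat.twoStepInduction with
  | zero => simp [wfun]
  | one => simpa [wfun] using ha (j + 1) (by omega)
  | more n h1 h2 =>
    simp only [wfun]
    have := ha (j + n + 2) (by omega)
    have := hb (j + n + 2) (by omega)
    positivity

lemma Sfun_pos {a b : ℕ → ℝ} {j : ℕ} (ha : ∀ k, j < k → 0 < a k) (hb : ∀ k, j < k → 0 < b k)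
    {n : ℕ} (hn : 1 ≤ n) : 0 < Sfun a b j n :=
  Finset.sum_pos (fun i _ => wfun_pos ha hb i) ⟨0, Finset.mem_range.2 (by omega)⟩

theorem prob_interface {q p1 p2 : ℕ → ℝ}
    (hq : ∀ k, 2 ≤ k → 0 < q k) (hp1 : ∀ k, 2 ≤ k → 0 ≤ p1 k)
    (hp2 : ∀ k, 2 ≤ k → 0 < p2 k)
    (hsum : ∀ k, 2 ≤ k → q k + p1 k + p2 k = 1)
    {μ : Measure (ℕ → ℕ)} [IsProbabilityMeasure μ]
    (hμ : IsMarkovChain μ (transX q p1 p2) 2) {S : ℕ → ℕ → ℝ}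
    (hS : S = Sfun (fun k => (p1 k + p2 k) / q k) (fun k => p2 k / q k)) :
    ∃ A : ℕ → Set (ℕ → ℕ), (∀ k, MeasurableSet (A k)) ∧
      (∀ᵐ ω ∂μ, ∀ k, 2 ≤ k → (ω ∈ A k ↔ ∃! n, ω n = k)) ∧
      (∀ k, 2 ≤ k → ∀ n, 1 ≤ n → μ.real (A k) ≤ q k / S k n) ∧
      (∀ k, 2 ≤ k → ∀ D, (∀ n, 1 ≤ n → S k n ≤ D) → q k / D ≤ μ.real (A k)) ∧
      (∀ j k N, 2 ≤ j → j < k → μ.real (A j ∩ (A k \ ⋃ l ∈ Finset.Ioc k N, A l)) =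
        q j / S j (k - j) * μ.real (A k \ ⋃ l ∈ Finset.Ioc k N, A l)) ∧
      (μ {ω | ∃ᶠ k in atTop, ω ∈ A k} = 0 ∨ μ {ω | ∃ᶠ k in atTop, ω ∈ A k} = 1) := by
  obtain ⟨P, rfl, hpr, hP⟩ := exists_family hq hp2 hμ
  have hSpos : ∀ j n, 2 ≤ j → 1 ≤ n → 0 < S j n := by
    intro j n hj hn
    rw [hS]
    refine Sfun_pos (fun k hk => ?_) (fun k hk => ?_) hn
    · have := hq k (by omega); have := hp1 k (by omega); have := hp2 k (by omega)
      positivity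
    · have := hq k (by omega); have := hp2 k (by omega)
      positivity
  refine ⟨Aset, meas_Aset, ?_, ?_, ?_, ?_, ?_⟩
  · filter_upwards [ae_good hq hp1 hp2 hsum hpr hP 2] with ω ⟨h0, hs, hu⟩ k hk
    exact cut_iff h0 hs hu hk
  · intro k hk n hn
    have h1 := prob_Kset_le hq hp1 hp2 hsum hpr hP k (k + n)
    rw [measureReal_def, Aset, prob_Lset hq hp1 hp2 hsum hpr hP hk (meas_Kset k), hS,
      ← ruin hq hp1 hp2 hsum hpr hP hk hn]
    have := hpr k
    exact ENNReal.toReal_mono (measure_ne_top _ _) h1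
  · intro k hk D hD
    have := hpr k
    have hkey : ENNReal.ofReal (q k / D) ≤ P k (Kset k) := by
      refine prob_Kset_ge hpr k fun n hn => ?_
      refine ENNReal.ofReal_le_of_le_toReal ?_
      have := ruin hq hp1 hp2 hsum hpr hP hk hn
      rw [measureReal_def, ← hS] at this
      rw [this]
      exact div_le_div_of_nonneg_left (hq k hk).le (hSpos k n hk hn) (hD n hn)
    rw [measureReal_def, Aset, prob_Lset hq hp1 hp2 hsum hpr hP hk (meas_Kset k)]
    have h := ENNReal.toReal_mono (measure_ne_top _ _) hkey
    rw [ENNReal.toReal_ofReal] at h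
    · exact h
    · have := hSpos k 1 hk le_rfl
      have := hD 1 le_rfl
      have := hq k hk
      exact div_nonneg (by linarith) (by linarith)
  · intro j k N hj hjk
    set G := Kset k \ ⋃ l ∈ Finset.Ioc k N, Aset l with hG
    have hGm : MeasurableSet G := (meas_Kset k).diff
      (Finset.measurableSet_biUnion _ fun l _ => meas_Aset l)
    have e : Aset k \ ⋃ l ∈ Finset.Ioc k N, Aset l = Lset k G := by
      ext ω
      constructor
      · rintro ⟨⟨m, h1, h2⟩, h3⟩
        refine ⟨m, h1, h2, fun h4 => h3 ?_⟩
        simp only [Set.mem_iUnion] at h4 ⊢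
        obtain ⟨l, hl, h5⟩ := h4
        exact ⟨l, hl, (Lset_shift (Finset.mem_Ioc.1 hl).1 h1 _).1 h5⟩
      · rintro ⟨m, h1, h2, h3⟩
        refine ⟨⟨m, h1, h2⟩, fun h4 => h3 ?_⟩
        simp only [Set.mem_iUnion] at h4 ⊢
        obtain ⟨l, hl, h5⟩ := h4
        exact ⟨l, hl, (Lset_shift (Finset.mem_Ioc.1 hl).1 h1 _).2 h5⟩
    have hr := ruin hq hp1 hp2 hsum hpr hP hj (n := k - j) (by omega)
    rw [Nat.add_sub_cancel' hjk.le] at hr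
    rw [e, measureReal_def, prob_Aset_Lset hq hp1 hp2 hsum hpr hP hj hjk hGm Set.sdiff_subset,
      ENNReal.toReal_mul, hS, ← hr]
    rfl
  · refine zero_one hq hp1 hp2 hsum hpr hP ?_ ?_
    · have : {ω : ℕ → ℕ | ∃ᶠ k in atTop, ω ∈ Aset k} = limsup Aset atTop := by
        ext ω; rw [mem_limsup_iff_frequently_mem]; rfl
      rw [this]
      exact MeasurableSet.measurableSet_limsup meas_Aset
    · intro k m ω h
      refine frequently_congr ?_
      filter_upwards [eventually_gt_atTop k] with l hl
      exact Lset_shift hl h _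

def psiF (β : ℝ) (k : ℕ) : ℝ := Real.log (Real.log (k : ℝ)) ^ β

lemma tendsto_log_nat : Tendsto (fun k : ℕ => Real.log (k : ℝ)) atTop atTop :=
  Real.tendsto_log_atTop.comp tendsto_natCast_atTop_atTop

lemma tendsto_loglog_nat : Tendsto (fun k : ℕ => Real.log (Real.log (k : ℝ))) atTop atTop :=
  Real.tendsto_log_atTop.comp tendsto_log_nat

lemma psi_div_log (β : ℝ) : Tendsto (fun k : ℕ => psiF β k / Real.log (k : ℝ)) atTop (𝓝 0) := by
  have h := isLittleO_log_rpow_rpow_atTop β (one_pos : (0:ℝ) < 1)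
  have h2 := (h.tendsto_div_nhds_zero).comp tendsto_log_nat
  refine h2.congr fun k => ?_
  simp [psiF]

lemma psi_le_log (β : ℝ) : ∀ᶠ k : ℕ in atTop, psiF β k ≤ Real.log (k : ℝ) := by
  filter_upwards [(psi_div_log β).eventually (ge_mem_nhds one_pos),
    tendsto_log_nat.eventually_gt_atTop 0] with k h1 h2
  rwa [div_le_one h2] at h1

lemma one_le_psi {β : ℝ} (hβ : 0 ≤ β) : ∀ᶠ k : ℕ in atTop, 1 ≤ psiF β k := by
  filter_upwards [tendsto_loglog_nat.eventually_ge_atTop 1] with k h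
  exact Real.one_le_rpow h hβ

lemma psi_mono {β : ℝ} (hβ : 0 ≤ β) {j k : ℕ} (hj : 3 ≤ j) (hjk : j ≤ k) :
    psiF β j ≤ psiF β k := by
  have h3 : 1 ≤ Real.log (j : ℝ) := by
    rw [Real.le_log_iff_exp_le (by positivity)]
    have : (3 : ℝ) ≤ j := by exact_mod_cast hj
    linarith [Real.exp_one_lt_d9]
  have hj0 : (0 : ℝ) < j := by positivity
  have h4 : Real.log (j : ℝ) ≤ Real.log (k : ℝ) :=
    Real.log_le_log hj0 (by exact_mod_cast hjk)
  refine Real.rpow_le_rpow (Real.log_nonneg h3) ?_ hβ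
  exact Real.log_le_log (by linarith) h4

lemma psi_div (β : ℝ) (hβ : 0 ≤ β) : Tendsto (fun k : ℕ => psiF β k / (k : ℝ)) atTop (𝓝 0) := by
  have h1 : Tendsto (fun k : ℕ => Real.log (k : ℝ) / (k : ℝ)) atTop (𝓝 0) := by
    have := Real.isLittleO_log_id_atTop.tendsto_div_nhds_zero.comp (tendsto_natCast_atTop_atTop (R := ℝ))
    exact this
  refine squeeze_zero' ?_ ?_ h1
  · filter_upwards [one_le_psi hβ] with k hk
    positivity
  · filter_upwards [psi_le_log β] with k hk
    gcongr

lemma log_sub_le {x y : ℝ} (hx : 0 < x) (hy : 0 < y) : Real.log y - Real.log x ≤ (y - x) / x := by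
  rw [← Real.log_div hy.ne' hx.ne']
  have := Real.log_le_sub_one_of_pos (div_pos hy hx)
  rw [sub_div, div_self hx.ne']
  exact this

lemma loglog_sub_le {k : ℕ} (hk : 3 ≤ k) :
    Real.log (Real.log ((k + 1 : ℕ) : ℝ)) - Real.log (Real.log (k : ℝ)) 
      ≤ 1 / (k * Real.log k) := by
  have hk0 : (3 : ℝ) ≤ k := by exact_mod_cast hk
  have h1 : 0 < Real.log (k : ℝ) := Real.log_pos (by linarith)
  have h2 : 0 < Real.log ((k + 1 : ℕ) : ℝ) := Real.log_pos (by push_cast; linarith)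
  refine (log_sub_le h1 h2).trans ?_
  have h3 := log_sub_le (x := (k : ℝ)) (y := ((k + 1 : ℕ) : ℝ)) (by linarith) (by positivity)
  rw [← div_div]
  gcongr
  refine h3.trans ?_
  push_cast
  rw [add_sub_cancel_left]

lemma psi_diff (β : ℝ) (hβ : 0 ≤ β) :
    Tendsto (fun k : ℕ => (k : ℝ) * (psiF β (k + 1) - psiF β k)) atTop (𝓝 0) := by
  have h1 : Tendsto (fun k : ℕ => 2 * β * (psiF β k / Real.log (k : ℝ))) atTop (𝓝 0) := by
    simpa using (psi_div_log β).const_mul (2 * β)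
  refine squeeze_zero' ?_ ?_ h1
  · filter_upwards [eventually_ge_atTop 3] with k hk
    have := psi_mono hβ hk (Nat.le_succ k)
    have h : 0 ≤ psiF β (k + 1) - psiF β k := by simpa using this
    positivity
  · have hz : Tendsto (fun k : ℕ => β * (1 / (k * Real.log k) : ℝ)) atTop (𝓝 0) := by
      have : Tendsto (fun k : ℕ => (k * Real.log k : ℝ)) atTop atTop :=
        tendsto_natCast_atTop_atTop.atTop_mul_atTop₀ tendsto_log_nat
      have h2 : Tendsto (fun k : ℕ => (1 / (k * Real.log k) : ℝ)) atTop (𝓝 0) := by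
        refine this.inv_tendsto_atTop.congr fun k => ?_
        simp only [Pi.inv_apply, one_div]
      simpa using h2.const_mul β
    filter_upwards [eventually_ge_atTop 3, tendsto_loglog_nat.eventually_ge_atTop 1,
      hz.eventually (ge_mem_nhds one_pos), one_le_psi hβ] with k hk hll hsm hpsi
    have hk0 : (3 : ℝ) ≤ k := by exact_mod_cast hk
    have hl : 0 < Real.log (k : ℝ) := Real.log_pos (by linarith)
    set x := Real.log (Real.log (k : ℝ)) with hx
    set y := Real.log (Real.log ((k + 1 : ℕ) : ℝ)) with hy
    have hxy : x ≤ y := by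
      refine Real.log_le_log hl (Real.log_le_log (by linarith) (by push_cast; linarith))
    have hd := loglog_sub_le hk
    rw [← hx, ← hy] at hd
    have ht : 0 ≤ β * (y - x) := mul_nonneg hβ (by linarith)
    have ht1 : β * (y - x) ≤ β * (1 / (k * Real.log k)) := by gcongr
    have hyx : y ^ β ≤ x ^ β * Real.exp (β * (y - x)) := by
      rw [Real.rpow_def_of_pos (by linarith), Real.rpow_def_of_pos (by linarith), ← Real.exp_add]
      refine Real.exp_le_exp.2 ?_
      have h5 : Real.log y - Real.log x ≤ y - x := by
        refine (log_sub_le (by linarith) (by linarith)).trans ?_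
        exact div_le_self (by linarith) hll
      nlinarith
    have hexp : Real.exp (β * (y - x)) - 1 ≤ 2 * (β * (y - x)) := by
      have := Real.abs_exp_sub_one_le (x := β * (y - x)) (by rw [abs_of_nonneg ht]; linarith)
      rw [abs_of_nonneg ht] at this
      exact (le_abs_self _).trans this
    have hpk : psiF β k = x ^ β := rfl
    have hpk1 : psiF β (k + 1) = y ^ β := rfl
    rw [hpk] at hpsi
    rw [hpk, hpk1]
    have h6 : y ^ β - x ^ β ≤ x ^ β * (2 * (β * (1 / (k * Real.log k)))) := by
      have : x ^ β * (Real.exp (β * (y - x)) - 1) ≤ x ^ β * (2 * (β * (1 / (k * Real.log k)))) := by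
        gcongr
        linarith
      linarith
    calc (k : ℝ) * (y ^ β - x ^ β) ≤ k * (x ^ β * (2 * (β * (1 / (k * Real.log k))))) := by gcongr
      _ = 2 * β * (x ^ β / Real.log k) := by field_simp

/-! ### comparison of the fundamental solution with a product -/

def piF (R : ℕ → ℝ) (j n : ℕ) : ℝ := ∏ i ∈ Finset.range n, R (j + 1 + i)

lemma piF_succ (R : ℕ → ℝ) (j n : ℕ) : piF R j (n + 1) = piF R j n * R (j + n + 1) := by
  rw [piF, Finset.prod_range_succ, piF]
  congr 2; ring

lemma piF_pos {R : ℕ → ℝ} {j : ℕ} (h : ∀ k, j ≤ k → 0 < R k) (n : ℕ) : 0 < piF R j n :=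
  Finset.prod_pos fun i _ => h _ (by omega)

lemma compare {a b R τ : ℕ → ℝ} {N : ℕ} {c0 : ℝ} (hc0 : 0 < c0) (hc1 : c0 ≤ 1)
    (ha : ∀ k, N ≤ k → 0 < a k) (hb : ∀ k, N ≤ k → 0 < b k) (hR : ∀ k, N ≤ k → 0 < R k)
    (hquad : ∀ k, N ≤ k → R k ^ 2 = a k * R k + b k)
    (haR : ∀ k, N ≤ k → c0 * R k ≤ a k)
    (hτ0 : ∀ k, N ≤ k → 0 ≤ τ k) (hτ1 : ∀ k, N ≤ k → τ k ≤ 1 / 4)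
    (hτ : ∀ k, N ≤ k → |R (k + 1) - R k| ≤ (τ k - τ (k + 1)) * R k)
    {j : ℕ} (hj : N ≤ j) (n : ℕ) :
    c0 / 2 * piF R j n ≤ wfun a b j n ∧ wfun a b j n ≤ 2 * piF R j n := by
  have hRj : ∀ k, j ≤ k → 0 < R k := fun k hk => hR k (hj.trans hk)
  -- one-step estimates
  have hstep : ∀ k, N ≤ k → 
      (1 - (τ k - τ (k + 1))) * (R (k + 1) * R k) ≤ a (k + 1) * R k + b (k + 1) ∧
      a (k + 1) * R k + b (k + 1) ≤ (1 + (τ k - τ (k + 1))) * (R (k + 1) * R k) := by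
    intro k hk
    have h1 := hquad (k + 1) (by omega)
    have r1 := hR (k + 1) (by omega)
    have r0 := hR k hk
    have hb' := hb (k + 1) (by omega)
    have ha' := ha (k + 1) (by omega)
    obtain ⟨t1, t2⟩ := abs_le.1 (hτ k hk)
    have hbR : b (k + 1) / R (k + 1) ≤ R (k + 1) := by
      rw [div_le_iff₀ r1]; nlinarith
    have hbR0 : 0 < b (k + 1) / R (k + 1) := by positivity
    have e : a (k + 1) * R k + b (k + 1) = 
        R (k + 1) * R k + b (k + 1) / R (k + 1) * (R (k + 1) - R k) := by
      have : a (k + 1) = R (k + 1) - b (k + 1) / R (k + 1) := by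
        field_simp; linarith
      rw [this]; field_simp; ring
    rw [e]
    set B := b (k + 1) / R (k + 1)
    have hd0 : 0 ≤ (τ k - τ (k + 1)) * R k := (abs_nonneg _).trans (hτ k hk)
    constructor
    · nlinarith [mul_le_mul_of_nonneg_right hbR hd0, mul_le_mul_of_nonneg_left t1 hbR0.le]
    · nlinarith [mul_le_mul_of_nonneg_right hbR hd0, mul_le_mul_of_nonneg_left t2 hbR0.le]
  have hdec : ∀ k, N ≤ k → 0 ≤ τ k - τ (k + 1) := by
    intro k hk
    have := (abs_nonneg _).trans (hτ k hk)
    exact nonneg_of_mul_nonneg_left this (hR k hk)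
  have ha1 : a (j + 1) ≤ R (j + 1) := by
    have h1 := hquad (j + 1) (by omega)
    have r1 := hR (j + 1) (by omega)
    have hb' := hb (j + 1) (by omega)
    by_contra hc
    push Not at hc
    nlinarith
  have hup : ∀ n, wfun a b j n ≤ Real.exp (τ (j + 1) - τ (j + 1 + n)) * piF R j n ∧ 
      wfun a b j (n + 1) ≤ Real.exp (τ (j + 1) - τ (j + 1 + n)) * piF R j (n + 1) := by
    intro n
    induction n with
    | zero => simp [wfun, piF, ha1]
    | succ n ih =>
      set E := Real.exp (τ (j + 1) - τ (j + 1 + n)) with hE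
      set d := τ (j + 1 + n) - τ (j + 1 + n + 1) with hd
      have hd0 : 0 ≤ d := hdec _ (by omega)
      have hE' : Real.exp (τ (j + 1) - τ (j + 1 + (n + 1))) = E * Real.exp d := by
        rw [hE, ← Real.exp_add]; congr 1; rw [hd, ← add_assoc]; ring
      have hEpos : 0 < E := Real.exp_pos _
      have hed : 1 + d ≤ Real.exp d := by linarith [Real.add_one_le_exp d]
      rw [hE']
      have hp1 := piF_pos hRj (n + 1)
      have hp0 := piF_pos hRj n
      constructor
      · refine ih.2.trans ?_
        gcongr
        nlinarith
      · have hs := (hstep (j + 1 + n) (by omega)).2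
        rw [← hd] at hs
        have a0 := ha (j + n + 2) (by omega)
        have b0 := hb (j + n + 2) (by omega)
        have r1 := hR (j + n + 1) (by omega)
        have r2 := hR (j + n + 2) (by omega)
        have i1 : j + 1 + n = j + n + 1 := by ring
        have i2 : j + 1 + n + 1 = j + n + 2 := by ring
        rw [i2, i1] at hs
        have i3 : j + (n + 1) + 1 = j + n + 2 := by ring
        rw [piF_succ R j (n + 1), i3]
        simp only [wfun]
        rw [piF_succ] at *
        calc a (j + n + 2) * wfun a b j (n + 1) + b (j + n + 2) * wfun a b j n 
            ≤ a (j + n + 2) * (E * (piF R j n * R (j + n + 1))) + b (j + n + 2) * (E * piF R j n) := by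
              gcongr
              · exact ih.2
              · exact ih.1
          _ = E * piF R j n * (a (j + n + 2) * R (j + n + 1) + b (j + n + 2)) := by ring
          _ ≤ E * piF R j n * ((1 + d) * (R (j + n + 2) * R (j + n + 1))) := by gcongr
          _ ≤ E * piF R j n * (Real.exp d * (R (j + n + 2) * R (j + n + 1))) := by gcongr
          _ = _ := by ring
  have hlo : ∀ n, c0 * Real.exp (-2 * (τ (j + 1) - τ (j + 1 + n))) * piF R j n ≤ wfun a b j n ∧ 
      c0 * Real.exp (-2 * (τ (j + 1) - τ (j + 1 + n))) * piF R j (n + 1) ≤ wfun a b j (n + 1) := by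
    intro n
    induction n with
    | zero => simpa [wfun, piF, hc1] using haR (j + 1) (by omega)
    | succ n ih =>
      set E := c0 * Real.exp (-2 * (τ (j + 1) - τ (j + 1 + n))) with hE
      set d := τ (j + 1 + n) - τ (j + 1 + n + 1) with hd
      have hd0 : 0 ≤ d := hdec _ (by omega)
      have hd1 : d ≤ 1 / 4 := by
        have := hτ1 (j + 1 + n) (by omega); have := hτ0 (j + 1 + n + 1) (by omega); linarith
      have hE' : c0 * Real.exp (-2 * (τ (j + 1) - τ (j + 1 + (n + 1)))) = E * Real.exp (-2 * d) := by
        rw [hE, mul_assoc, ← Real.exp_add]; congr 2; rw [hd, ← add_assoc]; ring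
      have hEpos : 0 < E := mul_pos hc0 (Real.exp_pos _)
      have hed : Real.exp (-2 * d) ≤ 1 - d := by
        have h1 : 1 + 2 * d ≤ Real.exp (2 * d) := by linarith [Real.add_one_le_exp (2 * d)]
        have h2 : Real.exp (-2 * d) * Real.exp (2 * d) = 1 := by
          rw [← Real.exp_add]; simp
        have h3 := Real.exp_pos (-2 * d)
        nlinarith
      rw [hE']
      have hp1 := piF_pos hRj (n + 1)
      have hp0 := piF_pos hRj n
      constructor
      · refine le_trans ?_ ih.2
        gcongr
        nlinarith
      · have hs := (hstep (j + 1 + n) (by omega)).1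
        rw [← hd] at hs
        have a0 := ha (j + n + 2) (by omega)
        have b0 := hb (j + n + 2) (by omega)
        have r1 := hR (j + n + 1) (by omega)
        have r2 := hR (j + n + 2) (by omega)
        have i1 : j + 1 + n = j + n + 1 := by ring
        have i2 : j + 1 + n + 1 = j + n + 2 := by ring
        rw [i2, i1] at hs
        have i3 : j + (n + 1) + 1 = j + n + 2 := by ring
        rw [piF_succ R j (n + 1), i3]
        simp only [wfun]
        rw [piF_succ] at *
        calc E * Real.exp (-2 * d) * (piF R j n * R (j + n + 1) * R (j + n + 2))
            = E * piF R j n * (Real.exp (-2 * d) * (R (j + n + 2) * R (j + n + 1))) := by ring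
          _ ≤ E * piF R j n * ((1 - d) * (R (j + n + 2) * R (j + n + 1))) := by gcongr
          _ ≤ E * piF R j n * (a (j + n + 2) * R (j + n + 1) + b (j + n + 2)) := by gcongr
          _ = a (j + n + 2) * (E * (piF R j n * R (j + n + 1))) + b (j + n + 2) * (E * piF R j n) := by ring
          _ ≤ a (j + n + 2) * wfun a b j (n + 1) + b (j + n + 2) * wfun a b j n := by
              gcongr
              · exact ih.2
              · exact ih.1
  have hp0 := piF_pos hRj n
  have t1 := hτ1 (j + 1) (by omega)
  have t2 := hτ0 (j + 1 + n) (by omega)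
  have hexp : Real.exp (1 / 2) ≤ 2 := by
    have h := Real.exp_one_lt_d9
    have h2 : Real.exp (1 / 2) * Real.exp (1 / 2) = Real.exp 1 := by
      rw [← Real.exp_add]; norm_num
    nlinarith [Real.exp_pos (1 / 2)]
  constructor
  · refine le_trans ?_ (hlo n).1
    have : 1 / 2 ≤ Real.exp (-2 * (τ (j + 1) - τ (j + 1 + n))) := by
      have h1 : Real.exp (-(1 / 2)) ≤ Real.exp (-2 * (τ (j + 1) - τ (j + 1 + n))) :=
        Real.exp_le_exp.2 (by linarith)
      refine le_trans ?_ h1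
      rw [Real.exp_neg, ← one_div]
      exact one_div_le_one_div_of_le (Real.exp_pos _) hexp
    have e : c0 / 2 = c0 * (1 / 2) := by ring
    rw [e]
    gcongr
  · refine (hup n).1.trans ?_
    gcongr
    exact (Real.exp_le_exp.2 (by linarith)).trans hexp

def Tsum (R : ℕ → ℝ) (j n : ℕ) : ℝ := ∑ t ∈ Finset.range n, piF R j t

lemma Tsum_succ (R : ℕ → ℝ) (j n : ℕ) : Tsum R j (n + 1) = Tsum R j n + piF R j n :=
  Finset.sum_range_succ _ _

section Tsec
variable {R ψ : ℕ → ℝ} {N : ℕ}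
  
lemma piF_zero (R : ℕ → ℝ) (j : ℕ) : piF R j 0 = 1 := by simp [piF]

lemma Tsum_mono (hR : ∀ k, N ≤ k → 0 < R k) {j : ℕ} (hj : N ≤ j) {m n : ℕ} (h : m ≤ n) :
    Tsum R j m ≤ Tsum R j n := by
  refine Finset.sum_le_sum_of_subset_of_nonneg (Finset.range_mono h) fun i _ _ => ?_
  exact (piF_pos (fun k hk => hR k (hj.trans hk)) i).le

lemma Tsum_le_n (hR : ∀ k, N ≤ k → 0 < R k) (hR1 : ∀ k, N ≤ k → R k ≤ 1)
    {j : ℕ} (hj : N ≤ j) (n : ℕ) : Tsum R j n ≤ n := by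
  have : ∀ t, piF R j t ≤ 1 := by
    intro t
    refine Finset.prod_le_one (fun i _ => (hR _ (by omega)).le) fun i _ => hR1 _ (by omega)
  calc Tsum R j n ≤ ∑ t ∈ Finset.range n, (1 : ℝ) := Finset.sum_le_sum fun t _ => this t
    _ = n := by simp

lemma Phi_bounds (hR : ∀ k, N ≤ k → 0 < R k)
    (H1 : ∀ k : ℕ, N ≤ k → 1 / 2 ≤ k * ψ k - (k + 1) * ψ (k + 1) * R (k + 1) ∧
      k * ψ k - (k + 1) * ψ (k + 1) * R (k + 1) ≤ 2)
    {j : ℕ} (hj : N ≤ j) (n : ℕ) :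
    Tsum R j n / 2 ≤ j * ψ j - ((j + n : ℕ) : ℝ) * ψ (j + n) * piF R j n ∧
    j * ψ j - ((j + n : ℕ) : ℝ) * ψ (j + n) * piF R j n ≤ 2 * Tsum R j n := by
  induction n with
  | zero => simp [Tsum, piF]
  | succ n ih =>
    have hp := piF_pos (fun k hk => hR k (hj.trans hk)) (j := j) n
    have h := H1 (j + n) (by omega)
    rw [Tsum_succ, piF_succ]
    have e : ((j + (n + 1) : ℕ) : ℝ) * ψ (j + (n + 1)) * (piF R j n * R (j + n + 1))
        = piF R j n * ((((j + n : ℕ) : ℝ) + 1) * ψ (j + n + 1) * R (j + n + 1)) := by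
      rw [← add_assoc]; push_cast; ring
    rw [e]
    obtain ⟨h1, h2⟩ := h
    have h1' := mul_le_mul_of_nonneg_left h1 hp.le
    have h2' := mul_le_mul_of_nonneg_left h2 hp.le
    rw [mul_sub] at h1' h2'
    constructor <;> nlinarith [ih.1, ih.2]

lemma Tsum_le_psi (hR : ∀ k, N ≤ k → 0 < R k) (hψ : ∀ k, N ≤ k → 1 ≤ ψ k)
    (H1 : ∀ k : ℕ, N ≤ k → 1 / 2 ≤ k * ψ k - (k + 1) * ψ (k + 1) * R (k + 1) ∧
      k * ψ k - (k + 1) * ψ (k + 1) * R (k + 1) ≤ 2)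
    {j : ℕ} (hj : N ≤ j) (n : ℕ) : Tsum R j n ≤ 2 * (j * ψ j) := by
  have h := (Phi_bounds hR H1 hj n).1
  have hp := piF_pos (fun k hk => hR k (hj.trans hk)) (j := j) n
  have := hψ (j + n) (by omega)
  have : 0 ≤ ((j + n : ℕ) : ℝ) * ψ (j + n) * piF R j n := by positivity
  linarith

lemma exists_Tsum_ge (hN : 3 ≤ N) (hR : ∀ k, N ≤ k → 0 < R k) (hψ : ∀ k, N ≤ k → 1 ≤ ψ k)
    (hψl : ∀ k : ℕ, N ≤ k → ψ k ≤ Real.log k)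
    (H1 : ∀ k : ℕ, N ≤ k → 1 / 2 ≤ k * ψ k - (k + 1) * ψ (k + 1) * R (k + 1) ∧
      k * ψ k - (k + 1) * ψ (k + 1) * R (k + 1) ≤ 2)
    {j : ℕ} (hj : N ≤ j) : ∃ n, 1 ≤ n ∧ j * ψ j / 4 ≤ Tsum R j n := by
  have hjψ : 0 < j * ψ j := by
    have := hψ j hj
    have : (0 : ℝ) < j := by exact_mod_cast (by omega : 0 < j)
    positivity
  by_cases hex : ∃ n, ((j + n : ℕ) : ℝ) * ψ (j + n) * piF R j n ≤ j * ψ j / 2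
  · obtain ⟨n, hn⟩ := hex
    have h := (Phi_bounds hR H1 hj n).2
    refine ⟨n + 1, by omega, ?_⟩
    have := Tsum_mono hR hj (Nat.le_succ n)
    simp only [Nat.succ_eq_add_one] at this
    linarith
  · push Not at hex
    exfalso
    have key : ∀ n : ℕ, j * ψ j / 2 * (Real.log (Real.log ((j + n : ℕ) : ℝ)) - Real.log (Real.log (j : ℝ)))
        ≤ Tsum R j n := by
      intro n
      induction n with
      | zero => simp [Tsum]
      | succ n ih =>
        rw [Tsum_succ]
        have h1 := loglog_sub_le (k := j + n) (by omega)
        have h2 := hex n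
        have hk : (0 : ℝ) < ((j + n : ℕ) : ℝ) := by exact_mod_cast (by omega : 0 < j + n)
        have hps := hψ (j + n) (by omega)
        have hpl := hψl (j + n) (by omega)
        have h3 : j * ψ j / 2 * (1 / (((j + n : ℕ) : ℝ) * Real.log ((j + n : ℕ) : ℝ))) ≤ piF R j n := by
          calc j * ψ j / 2 * (1 / (((j + n : ℕ) : ℝ) * Real.log ((j + n : ℕ) : ℝ)))
              ≤ j * ψ j / 2 * (1 / (((j + n : ℕ) : ℝ) * ψ (j + n))) := by gcongr
            _ ≤ piF R j n := by
              rw [mul_one_div, div_le_iff₀ (by positivity)]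
              linarith
        have h4 := mul_le_mul_of_nonneg_left h1 (by positivity : 0 ≤ j * ψ j / 2)
        rw [← add_assoc]
        linarith
    have ht : Tendsto (fun n : ℕ => Real.log (Real.log ((j + n : ℕ) : ℝ))) atTop atTop :=
      tendsto_loglog_nat.comp (tendsto_atTop_mono (fun n => Nat.le_add_left n j) tendsto_id)
    obtain ⟨n, hn⟩ := (ht.eventually_ge_atTop (Real.log (Real.log (j : ℝ)) + 5)).exists
    have h5 := Tsum_le_psi hR hψ H1 hj n
    have h6 := key n
    nlinarith

lemma Tsum_ge (hN : 3 ≤ N) (hR : ∀ k, N ≤ k → 0 < R k) (hψ : ∀ k, N ≤ k → 1 ≤ ψ k)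
    (hψm : ∀ j k, N ≤ j → j ≤ k → ψ j ≤ ψ k)
    (H2 : ∀ k : ℕ, N ≤ k → k - (k + 1) * R (k + 1) ≤ 2 / ψ (k + 1))
    {j : ℕ} (hj : N ≤ j) (n : ℕ) :
    1 / 4 * min (j * (Real.log ((j + n : ℕ) : ℝ) - Real.log (j : ℝ))) (j * ψ j) ≤ Tsum R j n := by
  have hj0 : (0 : ℝ) < j := by exact_mod_cast (by omega : 0 < j)
  have hψj := hψ j hj
  have hG : ∀ t : ℕ, (j : ℝ) - ((j + t : ℕ) : ℝ) * piF R j t ≤ 2 / ψ j * Tsum R j t := by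
    intro t
    induction t with
    | zero => simp [Tsum, piF]
    | succ t ih =>
      have hp := piF_pos (fun k hk => hR k (hj.trans hk)) (j := j) t
      have h := H2 (j + t) (by omega)
      have h' : 2 / ψ (j + t + 1) ≤ 2 / ψ j := by
        have := hψm j (j + t + 1) hj (by omega)
        gcongr
      rw [Tsum_succ, piF_succ]
      have h2 := mul_le_mul_of_nonneg_left (h.trans h') hp.le
      have e : ((j + (t + 1) : ℕ) : ℝ) * (piF R j t * R (j + t + 1))
        = piF R j t * ((((j + t : ℕ) : ℝ) + 1) * R (j + t + 1)) := by
        rw [← add_assoc]; push_cast; ring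
      rw [e]
      rw [mul_sub] at h2
      nlinarith
  by_cases hall : ∀ t, t < n → (j : ℝ) / 2 ≤ ((j + t : ℕ) : ℝ) * piF R j t
  · have key : ∀ m, m ≤ n → j / 2 * (Real.log ((j + m : ℕ) : ℝ) - Real.log (j : ℝ)) ≤ Tsum R j m := by
      intro m hm
      induction m with
      | zero => simp [Tsum]
      | succ m ih =>
        have ih := ih (by omega)
        rw [Tsum_succ]
        have hk : (0 : ℝ) < ((j + m : ℕ) : ℝ) := by exact_mod_cast (by omega : 0 < j + m)
        have h1 := log_sub_le (x := ((j + m : ℕ) : ℝ)) (y := ((j + (m + 1) : ℕ) : ℝ)) hk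
          (by positivity)
        have e : (((j + (m + 1) : ℕ) : ℝ) - ((j + m : ℕ) : ℝ)) = 1 := by push_cast; ring
        rw [e] at h1
        have h2 := hall m (by omega)
        have h3 : (j : ℝ) / 2 * (1 / ((j + m : ℕ) : ℝ)) ≤ piF R j m := by
          rw [mul_one_div, div_le_iff₀ hk]; linarith
        have h4 := mul_le_mul_of_nonneg_left h1 (by positivity : (0 : ℝ) ≤ j / 2)
        linarith
    have h := key n le_rfl
    have hlog : Real.log (j : ℝ) ≤ Real.log ((j + n : ℕ) : ℝ) :=
      Real.log_le_log hj0 (by push_cast; linarith [(Nat.cast_nonneg n : (0 : ℝ) ≤ n)])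
    have hnn : 0 ≤ (j : ℝ) * (Real.log ((j + n : ℕ) : ℝ) - Real.log (j : ℝ)) :=
      mul_nonneg hj0.le (by linarith)
    have := min_le_left (j * (Real.log ((j + n : ℕ) : ℝ) - Real.log (j : ℝ))) (j * ψ j)
    linarith
  · push Not at hall
    obtain ⟨t, ht, hlt⟩ := hall
    have h1 := hG t
    have h2 := Tsum_mono hR hj ht.le
    have h3 : (j : ℝ) / 2 ≤ 2 / ψ j * Tsum R j n := by
      have := mul_le_mul_of_nonneg_left h2 (by positivity : 0 ≤ 2 / ψ j)
      linarith
    rw [div_mul_eq_mul_div, le_div_iff₀ (by linarith)] at h3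
    have := min_le_right (j * (Real.log ((j + n : ℕ) : ℝ) - Real.log (j : ℝ))) (j * ψ j)
    linarith

end Tsec

def tF (β : ℝ) (k : ℕ) : ℝ := 1 / (k : ℝ) * (1 + 1 / psiF β k)

lemma S_bounds {a b R : ℕ → ℝ} {β C a0 : ℝ} (hβ : 0 ≤ β) (hC : 0 < C)
    (ha0 : 0 < a0) (hlim : Tendsto a atTop (𝓝 a0))
    (hb : ∀ᶠ k in atTop, 0 < b k)
    (hquad : ∀ᶠ k in atTop, R k ^ 2 = a k * R k + b k)
    (hR : ∀ᶠ k : ℕ in atTop, |R k - (1 - tF β k)| ≤ C / (k : ℝ) ^ 2) :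
    ∃ (N : ℕ) (c D : ℝ), 3 ≤ N ∧ 0 < c ∧ 0 < D ∧ ∀ j : ℕ, N ≤ j → 1 ≤ psiF β j ∧
      (∀ n : ℕ, Sfun a b j n ≤ D * n) ∧
      (∃ n, 1 ≤ n ∧ c * (j * psiF β j) ≤ Sfun a b j n) ∧
      (∀ n, Sfun a b j n ≤ D * (j * psiF β j)) ∧
      (∀ n : ℕ, c * min (j * (Real.log ((j + n : ℕ) : ℝ) - Real.log (j : ℝ))) (j * psiF β j)
        ≤ Sfun a b j n) := by
  have hψ := one_le_psi hβ
  have hinv : Tendsto (fun k : ℕ => 1 / (k : ℝ)) atTop (𝓝 0) := tendsto_one_div_atTop_nhds_zero_nat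
  have hpsd : Tendsto (fun k : ℕ => C * (psiF β (k + 1) / ((k + 1 : ℕ) : ℝ))) atTop (𝓝 0) := by
    have := ((psi_div β hβ).comp (tendsto_add_atTop_nat 1)).const_mul C
    simpa using this
  have hkn : ∀ x : ℝ, ∀ᶠ k : ℕ in atTop, x ≤ (k : ℝ) := fun x =>
    (tendsto_natCast_atTop_atTop (R := ℝ)).eventually_ge_atTop x
  have ht2 : ∀ᶠ k : ℕ in atTop, tF β k ≤ 2 / k ∧ 1 / k ≤ tF β k := by
    filter_upwards [hψ, hkn 1] with k hk hk1
    have h1 : 1 / psiF β k ≤ 1 := by rw [div_le_one (by linarith)]; exact hk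
    have h2 : 0 ≤ 1 / psiF β k := by positivity
    have h3 : (0 : ℝ) < 1 / k := by positivity
    unfold tF
    constructor
    · rw [show (2 : ℝ) / k = 1 / k * 2 by ring]
      exact mul_le_mul_of_nonneg_left (by linarith) h3.le
    · nlinarith
  have hR1 : ∀ᶠ k in atTop, 1 / 2 ≤ R k ∧ R k ≤ 1 := by
    filter_upwards [hR, ht2, hkn 1, hkn C, hkn (4 + 4 * C)] with k h1 h2 h3 h4 h5
    have h6 : C / (k : ℝ) ^ 2 ≤ 1 / k := by
      rw [div_le_div_iff₀ (by positivity) (by positivity)]; nlinarith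
    have h7 := abs_le.1 h1
    have h8 : C / (k : ℝ) ^ 2 ≤ C / k := by
      gcongr; nlinarith
    have h9 : (2 + C) / k ≤ 1 / 2 := by
      rw [div_le_div_iff₀ (by positivity) (by positivity)]; linarith
    have h10 : (2 + C) / k = 2 / k + C / k := add_div _ _ _
    constructor <;> linarith [h7.1, h7.2, h2.1, h2.2]
  have hmono : ∀ᶠ k : ℕ in atTop, tF β (k + 1) ≤ tF β k := by
    filter_upwards [hψ, eventually_ge_atTop 3] with k h1 h2
    have h3 := psi_mono hβ h2 (Nat.le_succ k)
    have hk : (0 : ℝ) < k := by positivity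
    simp only [Nat.succ_eq_add_one] at h3
    unfold tF
    have : (k : ℝ) ≤ ((k + 1 : ℕ) : ℝ) := by push_cast; linarith
    have h4 : 0 < psiF β (k + 1) := by linarith
    have h5 : 0 ≤ 1 + 1 / psiF β (k + 1) := by positivity
    gcongr
  have hR' : ∀ᶠ k : ℕ in atTop, |R (k + 1) - (1 - tF β (k + 1))| ≤ C / ((k + 1 : ℕ) : ℝ) ^ 2 :=
    (tendsto_add_atTop_nat 1).eventually hR
  set τ : ℕ → ℝ := fun k => 2 * tF β k + 8 * C / k with hτ
  have hτ0 : ∀ᶠ k in atTop, 0 ≤ τ k := by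
    filter_upwards [ht2] with k h
    have : 0 ≤ tF β k := le_trans (by positivity) h.2
    positivity
  have hτ1 : ∀ᶠ k in atTop, τ k ≤ 1 / 4 := by
    filter_upwards [ht2, hkn 1, hkn (16 + 32 * C)] with k h h1 h2
    have h3 : (4 + 8 * C) / k ≤ 1 / 4 := by
      rw [div_le_div_iff₀ (by positivity) (by positivity)]; linarith
    have h4 : (4 + 8 * C) / k = 2 * (2 / k) + 8 * C / k := by ring
    simp only [hτ]
    linarith [h.1]
  have hτd : ∀ᶠ k : ℕ in atTop, |R (k + 1) - R k| ≤ (τ k - τ (k + 1)) * R k := by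
    filter_upwards [hR, hR', hmono, hR1, hkn 1] with k h1 h2 h3 h4 h5
    have e1 : C / ((k + 1 : ℕ) : ℝ) ^ 2 ≤ C / (k : ℝ) ^ 2 := by
      push_cast; gcongr; linarith
    have e2 : C / (k : ℝ) ^ 2 ≤ 2 * C / k - 2 * C / ((k + 1 : ℕ) : ℝ) := by
      push_cast
      rw [div_sub_div _ _ (by positivity) (by positivity), div_le_div_iff₀ (by positivity) (by positivity)]
      have : 0 ≤ C * k * (k - 1) := mul_nonneg (by positivity) (by linarith)
      nlinarith
    have e3 : |R (k + 1) - R k| ≤ (tF β k - tF β (k + 1)) + 2 * (C / (k : ℝ) ^ 2) := by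
      have h1' := abs_le.1 h1
      have h2' := abs_le.1 h2
      rw [abs_le]
      constructor <;> linarith [h1'.1, h1'.2, h2'.1, h2'.2]
    have e4 : τ k - τ (k + 1) = 2 * ((tF β k - tF β (k + 1)) +
        2 * (2 * C / k - 2 * C / ((k + 1 : ℕ) : ℝ))) := by
      simp only [hτ]; ring
    have e5 : 0 ≤ C / (k : ℝ) ^ 2 := by positivity
    rw [e4]
    nlinarith [h4.1]
  have hH1 : ∀ᶠ k : ℕ in atTop, 1 / 2 ≤ k * psiF β k - (k + 1) * psiF β (k + 1) * R (k + 1) ∧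
      k * psiF β k - (k + 1) * psiF β (k + 1) * R (k + 1) ≤ 2 := by
    filter_upwards [hR', hpsd.eventually (ge_mem_nhds (by norm_num : (0 : ℝ) < 1 / 4)),
      (psi_diff β hβ).eventually (ge_mem_nhds (by norm_num : (0 : ℝ) < 1 / 4)),
      (psi_diff β hβ).eventually (le_mem_nhds (by norm_num : -(1 / 4 : ℝ) < 0)),
      (tendsto_add_atTop_nat 1).eventually hψ] with k h1 h2 h3 h4 h5
    set K : ℝ := ((k + 1 : ℕ) : ℝ) with hK
    have hK1 : (k : ℝ) + 1 = K := by simp [hK]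
    have hK0 : 0 < K := by rw [← hK1]; positivity
    have hp0 : 0 < psiF β (k + 1) := by linarith
    have e1 : K * psiF β (k + 1) * (1 - tF β (k + 1)) = k * psiF β (k + 1) - 1 := by
      unfold tF
      rw [← hK]
      field_simp
      rw [← hK1]; ring
    have e2 : K * psiF β (k + 1) * |R (k + 1) - (1 - tF β (k + 1))| ≤ 1 / 4 := by
      refine le_trans (mul_le_mul_of_nonneg_left h1 (by positivity)) ?_
      refine le_trans (le_of_eq ?_) h2
      field_simp
    rw [← abs_of_pos (by positivity : 0 < K * psiF β (k + 1)), ← abs_mul, mul_sub, e1, abs_le] at e2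
    rw [hK1]
    constructor <;> nlinarith [e2.1, e2.2]
  have hH2 : ∀ᶠ k : ℕ in atTop, k - (k + 1) * R (k + 1) ≤ 2 / psiF β (k + 1) := by
    filter_upwards [hR', hpsd.eventually (ge_mem_nhds (by norm_num : (0 : ℝ) < 1)),
      (tendsto_add_atTop_nat 1).eventually hψ] with k h1 h2 h5
    set K : ℝ := ((k + 1 : ℕ) : ℝ) with hK
    have hK1 : (k : ℝ) + 1 = K := by simp [hK]
    have hK0 : 0 < K := by rw [← hK1]; positivity
    have hp0 : 0 < psiF β (k + 1) := by linarith
    have e1 : K * (1 - tF β (k + 1)) = k - 1 / psiF β (k + 1) := by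
      unfold tF
      rw [← hK]
      field_simp
      rw [← hK1]; ring
    have e2 : K * (C / K ^ 2) ≤ 1 / psiF β (k + 1) := by
      rw [le_div_iff₀ hp0]
      refine le_trans (le_of_eq ?_) h2
      field_simp
    have e3 := mul_le_mul_of_nonneg_left (abs_le.1 h1).1 hK0.le
    have e4 : 2 / psiF β (k + 1) = 1 / psiF β (k + 1) + 1 / psiF β (k + 1) := by ring
    rw [hK1, e4]
    nlinarith
  have ha : ∀ᶠ k in atTop, min (a0 / 2) 1 ≤ a k := by
    filter_upwards [hlim.eventually (le_mem_nhds (by linarith : a0 / 2 < a0))] with k hk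
    exact (min_le_left _ _).trans hk
  have hall := ((hψ.and (psi_le_log β)).and (hR1.and (hτ0.and hτ1))).and
    ((hτd.and (hH1.and hH2)).and ((ha.and hb).and hquad))
  obtain ⟨N0, hN0⟩ := eventually_atTop.1 hall
  set N := max N0 3 with hN
  have hNN : ∀ k, N ≤ k → N0 ≤ k := fun k hk => (le_max_left _ _).trans hk
  have hN3 : 3 ≤ N := le_max_right _ _
  set c0 := min (a0 / 2) 1 with hc0
  have hc0p : 0 < c0 := lt_min (by linarith) one_pos
  have hRp : ∀ k, N ≤ k → 0 < R k := fun k hk => by linarith [(hN0 k (hNN k hk)).1.2.1.1]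
  have hRle : ∀ k, N ≤ k → R k ≤ 1 := fun k hk => (hN0 k (hNN k hk)).1.2.1.2
  have hψN : ∀ k, N ≤ k → 1 ≤ psiF β k := fun k hk => (hN0 k (hNN k hk)).1.1.1
  have hψl : ∀ k, N ≤ k → psiF β k ≤ Real.log k := fun k hk => (hN0 k (hNN k hk)).1.1.2
  have haN : ∀ k, N ≤ k → c0 ≤ a k := fun k hk => (hN0 k (hNN k hk)).2.2.1.1
  have hcomp := fun (j : ℕ) (hj : N ≤ j) (n : ℕ) =>
    compare (a := a) (b := b) (R := R) (τ := τ) (N := N) hc0p (min_le_right _ _)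
      (fun k hk => hc0p.trans_le (haN k hk)) (fun k hk => (hN0 k (hNN k hk)).2.2.1.2) hRp
      (fun k hk => (hN0 k (hNN k hk)).2.2.2)
      (fun k hk => by nlinarith [hRle k hk, haN k hk])
      (fun k hk => (hN0 k (hNN k hk)).1.2.2.1) (fun k hk => (hN0 k (hNN k hk)).1.2.2.2)
      (fun k hk => (hN0 k (hNN k hk)).2.1.1) hj n
  have H1N := fun k (hk : N ≤ k) => (hN0 k (hNN k hk)).2.1.2.1
  have H2N := fun k (hk : N ≤ k) => (hN0 k (hNN k hk)).2.1.2.2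
  have hlow : ∀ j, N ≤ j → ∀ n, c0 / 2 * Tsum R j n ≤ Sfun a b j n := by
    intro j hj n
    rw [Tsum, Sfun, Finset.mul_sum]
    exact Finset.sum_le_sum fun t _ => (hcomp j hj t).1
  have hupp : ∀ j, N ≤ j → ∀ n, Sfun a b j n ≤ 2 * Tsum R j n := by
    intro j hj n
    rw [Tsum, Sfun, Finset.mul_sum]
    exact Finset.sum_le_sum fun t _ => (hcomp j hj t).2
  refine ⟨N, c0 / 8, 4, hN3, by positivity, by norm_num, fun j hj => ⟨hψN j hj, ?_, ?_, ?_, ?_⟩⟩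
  · intro n
    have h1 := hupp j hj n
    have h2 := Tsum_le_n hRp hRle hj n
    have : (0 : ℝ) ≤ n := Nat.cast_nonneg n
    linarith
  · obtain ⟨n, hn, h⟩ := exists_Tsum_ge hN3 hRp hψN hψl H1N hj
    refine ⟨n, hn, le_trans ?_ (hlow j hj n)⟩
    nlinarith
  · intro n
    have h1 := hupp j hj n
    have h2 := Tsum_le_psi hRp hψN H1N hj n
    linarith
  · intro n
    have h := Tsum_ge hN3 hRp hψN (fun j k hj hk => psi_mono hβ (hN3.trans hj) hk) H2N hj n
    refine le_trans ?_ (hlow j hj n)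
    nlinarith

lemma main_bounds (q p1 p2 : ℕ → ℝ)
    (hq : ∀ k, 2 ≤ k → 0 < q k) (hp1 : ∀ k, 2 ≤ k → 0 ≤ p1 k)
    (hp2 : ∀ k, 2 ≤ k → 0 < p2 k)
    (hsum : ∀ k, 2 ≤ k → q k + p1 k + p2 k = 1)
    (a : ℝ) (ha : 0 < a)
    (hCa : Tendsto (fun k => (p1 k + p2 k) / q k) atTop (𝓝 a))
    (β : ℝ) (hβ : 0 ≤ β)
    (hrho : (fun k => rho q p1 p2 k - (1 - 3 * rseq β k))
      =O[atTop] fun k => rseq β k ^ 2) :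
    ∃ (N : ℕ) (c D : ℝ), 3 ≤ N ∧ 0 < c ∧ 0 < D ∧ ∀ j : ℕ, N ≤ j → 1 ≤ psiF β j ∧ c ≤ q j ∧ q j ≤ 1 ∧
      (∀ n : ℕ, Sfun (fun k => (p1 k + p2 k)/q k) (fun k => p2 k/q k) j n ≤ D * n) ∧
      (∃ n, 1 ≤ n ∧ c * (j * psiF β j) ≤ Sfun (fun k => (p1 k + p2 k)/q k) (fun k => p2 k/q k) j n) ∧
      (∀ n, Sfun (fun k => (p1 k + p2 k)/q k) (fun k => p2 k/q k) j n ≤ D * (j * psiF β j)) ∧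
      (∀ n : ℕ, c * min (j * (Real.log ((j + n : ℕ) : ℝ) - Real.log (j : ℝ))) (j * psiF β j)
        ≤ Sfun (fun k => (p1 k + p2 k)/q k) (fun k => p2 k/q k) j n) := by
  obtain ⟨C, hC, hO⟩ := hrho.exists_pos
  have hO := hO.bound
  have hb : ∀ᶠ k in atTop, 0 < p2 k / q k := by
    filter_upwards [eventually_ge_atTop 2] with k hk
    exact div_pos (hp2 k hk) (hq k hk)
  have hquad : ∀ᶠ k in atTop, rho q p1 p2 k ^ 2
      = (p1 k + p2 k) / q k * rho q p1 p2 k + p2 k / q k := by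
    filter_upwards [hb] with k hk
    have hs := Real.sq_sqrt (by positivity :
      0 ≤ ((p1 k + p2 k) / q k) ^ 2 + 4 * (p2 k / q k))
    unfold rho
    nlinarith
  have h3r : ∀ k : ℕ, 4 ≤ k → 3 * rseq β k = tF β k := by
    intro k hk
    rw [rseq, if_pos hk, tF, psiF]
    rw [← one_div_mul_one_div]
    ring
  have hR : ∀ᶠ k : ℕ in atTop, |rho q p1 p2 k - (1 - tF β k)| ≤ C / (k : ℝ) ^ 2 := by
    filter_upwards [hO, eventually_ge_atTop 4, one_le_psi hβ] with k h1 h2 h3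
    have e := h3r k h2
    rw [e, Real.norm_eq_abs, Real.norm_eq_abs, abs_of_nonneg (sq_nonneg (rseq β k))] at h1
    refine h1.trans ?_
    have hk : (0 : ℝ) < k := by positivity
    have h4 : 1 / psiF β k ≤ 1 := by rw [div_le_one (by linarith)]; exact h3
    have h5 : 0 ≤ 1 / psiF β k := by positivity
    have h6 : rseq β k = 1 / k * ((1 + 1 / psiF β k) / 3) := by
      rw [tF] at e; linarith
    rw [h6, mul_pow, div_eq_mul_one_div C, ← one_div_pow]
    have : ((1 + 1 / psiF β k) / 3) ^ 2 ≤ 1 := by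
      rw [sq_le_one_iff₀ (by positivity)]; linarith
    refine mul_le_mul_of_nonneg_left ?_ hC.le
    exact mul_le_of_le_one_right (by positivity) this
  obtain ⟨N, c, D, hN, hc, hD, H⟩ := S_bounds hβ hC ha hCa hb hquad hR
  obtain ⟨N1, hN1⟩ := eventually_atTop.1 (hCa.eventually (ge_mem_nhds (by linarith : a < a + 1)))
  refine ⟨max N N1, min c (1 / (a + 2)), D, hN.trans (le_max_left _ _), lt_min hc (by positivity), hD, ?_⟩
  intro j hj
  obtain ⟨h1, h2, ⟨n, hn, h3⟩, h4, h5⟩ := H j ((le_max_left _ _).trans hj)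
  have hj3 : 3 ≤ j := hN.trans ((le_max_left _ _).trans hj)
  have hq' := hq j (by omega)
  have hs := hsum j (by omega)
  have hp := hp1 j (by omega)
  have hp' := hp2 j (by omega)
  have hj0 : (0 : ℝ) < j := by positivity
  refine ⟨h1, ?_, by linarith, h2, ⟨n, hn, le_trans ?_ h3⟩, h4, fun n => le_trans ?_ (h5 n)⟩
  · refine (min_le_right _ _).trans ?_
    have := hN1 j ((le_max_right _ _).trans hj)
    rw [div_le_iff₀ hq'] at this
    rw [div_le_iff₀ (by positivity)]
    nlinarith
  · have := min_le_left c (1 / (a + 2))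
    gcongr
  · have := min_le_left c (1 / (a + 2))
    have hlog : Real.log (j : ℝ) ≤ Real.log ((j + n : ℕ) : ℝ) :=
      Real.log_le_log hj0 (by push_cast; linarith [(Nat.cast_nonneg n : (0 : ℝ) ≤ n)])
    refine mul_le_mul_of_nonneg_right this ?_
    refine le_min (mul_nonneg hj0.le (by linarith)) (by positivity)

def Hs (n : ℕ) : ℝ := ∑ i ∈ Finset.range n, 1 / ((i : ℝ) + 1)

lemma Hs_eq (n : ℕ) : Hs n = ((harmonic n : ℚ) : ℝ) := by
  simp [Hs, harmonic]

lemma Hs_le (n : ℕ) : Hs n ≤ 1 + Real.log n := by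
  rw [Hs_eq]; exact harmonic_le_one_add_log n

lemma le_Hs (n : ℕ) : Real.log ((n + 1 : ℕ) : ℝ) ≤ Hs n := by
  rw [Hs_eq]; exact log_add_one_le_harmonic n

lemma sum_inv_rev (M k : ℕ) (h : M ≤ k) :
    ∑ j ∈ Finset.Ico M k, 1 / ((k : ℝ) - j) = Hs (k - M) := by
  rw [Finset.sum_Ico_eq_sum_range, Hs, ← Finset.sum_range_reflect]
  refine Finset.sum_congr rfl fun i hi => ?_
  have := Finset.mem_range.1 hi
  congr 1
  have e : ((k - M - 1 - i : ℕ) : ℝ) = (k : ℝ) - M - 1 - i := by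
    rw [Nat.cast_sub (by omega), Nat.cast_sub (by omega), Nat.cast_sub h]; simp
  push_cast [e]
  ring

lemma sum_inv_le (M k : ℕ) (hM : 1 ≤ M) (hk : M ≤ k) :
    ∑ j ∈ Finset.Ico M k, 1 / (j : ℝ) ≤ 1 + Real.log k := by
  refine le_trans ?_ (Hs_le k)
  have : Hs k = ∑ j ∈ Finset.Ico 1 (k + 1), 1 / (j : ℝ) := by
    rw [Finset.sum_Ico_eq_sum_range, Hs]
    refine Finset.sum_congr (by simp) fun i _ => ?_
    push_cast; ring
  rw [this]
  refine Finset.sum_le_sum_of_subset_of_nonneg ?_ fun i _ _ => by positivity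
  intro i hi
  simp only [Finset.mem_Ico] at hi ⊢
  omega

/-! ### Convergence part -/

lemma block_bound {Ω : Type*} [MeasurableSpace Ω] {μ : Measure Ω} [IsProbabilityMeasure μ]
    {A : ℕ → Set Ω} (hA : ∀ k, MeasurableSet (A k)) {ψ : ℕ → ℝ} {g : ℕ → ℕ → ℝ}
    {N : ℕ} {c C : ℝ} (hc : 0 < c) (hC : 0 < C) (hN : 1 ≤ N)
    (hψ : ∀ k, N ≤ k → 1 ≤ ψ k) (hψm : ∀ j k, N ≤ j → j ≤ k → ψ j ≤ ψ k)
    (hu : ∀ k : ℕ, N ≤ k → μ.real (A k) ≤ C / (k * ψ k))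
    (hg : ∀ j k : ℕ, N ≤ j → j < k → c / ((k : ℝ) - j) ≤ g j k)
    (hpair : ∀ j k n : ℕ, N ≤ j → j < k → μ.real (A j ∩ (A k \ ⋃ l ∈ Finset.Ioc k n, A l))
      = g j k * μ.real (A k \ ⋃ l ∈ Finset.Ioc k n, A l))
    {m : ℕ} (hm : N ≤ 2 ^ m) :
    (c * (m * Real.log 2)) * μ.real (⋃ k ∈ Finset.Ico (2 ^ (m + 1)) (2 ^ (m + 2)), A k)
      ≤ 3 * C / ψ (2 ^ m) := by
  set n := 2 ^ (m + 2) - 1 with hn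
  have hp2 : 2 ^ (m + 2) = 4 * 2 ^ m := by ring
  have hp1 : 2 ^ (m + 1) = 2 * 2 ^ m := by ring
  have hp0 : 0 < 2 ^ m := by positivity
  set F := Finset.Ico (2 ^ (m + 1)) (2 ^ (m + 2)) with hF
  set E := Finset.Ico (2 ^ m) (2 ^ (m + 2)) with hE
  set Lk : ℕ → Set Ω := fun k => A k \ ⋃ l ∈ Finset.Ioc k n, A l with hLk
  have hLm : ∀ k, MeasurableSet (Lk k) := fun k =>
    (hA k).diff (Finset.measurableSet_biUnion _ fun l _ => hA l)
  have hdis : ∀ k ∈ F, ∀ l ∈ F, k < l → Disjoint (Lk k) (Lk l) := by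
    intro k hk l hl hkl
    rw [Set.disjoint_left]
    intro ω h1 h2
    refine h1.2 (Set.mem_biUnion (x := l) ?_ h2.1)
    simp only [hF, Finset.mem_Ico] at hl
    simp only [Finset.coe_Ioc, Set.mem_Ioc]
    omega
  have hdis' : (↑F : Set ℕ).PairwiseDisjoint Lk := by
    intro k hk l hl hkl
    rcases lt_or_gt_of_ne hkl with h | h
    · exact hdis k hk l hl h
    · exact (hdis l hl k hk h).symm
  have hU : (⋃ k ∈ F, A k) ⊆ ⋃ k ∈ F, Lk k := by
    intro ω hω
    simp only [Set.mem_iUnion, exists_prop] at hω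
    classical
    let G := F.filter (fun k => ω ∈ A k)
    have hG : G.Nonempty := by
      obtain ⟨k, hk, h⟩ := hω
      exact ⟨k, Finset.mem_filter.2 ⟨hk, h⟩⟩
    have hmem := Finset.max'_mem G hG
    obtain ⟨h1, h2⟩ := Finset.mem_filter.1 hmem
    simp only [Set.mem_iUnion, exists_prop]
    refine ⟨G.max' hG, h1, h2, ?_⟩
    simp only [Set.mem_iUnion, exists_prop, not_exists, not_and]
    intro l hl hlA
    rw [Finset.mem_Ioc] at hl
    rw [hF, Finset.mem_Ico] at h1
    have : l ∈ G := Finset.mem_filter.2 ⟨by rw [hF, Finset.mem_Ico]; omega, hlA⟩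
    exact absurd (Finset.le_max' G l this) (by omega)
  have h1 : μ.real (⋃ k ∈ F, A k) ≤ ∑ k ∈ F, μ.real (Lk k) :=
    (measureReal_mono hU (measure_ne_top _ _)).trans (measureReal_biUnion_finset_le F Lk)
  have h2 : ∀ j ∈ E, ∑ k ∈ F, (if j < k then μ.real (A j ∩ Lk k) else 0) ≤ μ.real (A j) := by
    intro j _
    have e : ∑ k ∈ F, (if j < k then μ.real (A j ∩ Lk k) else 0) ≤ ∑ k ∈ F, μ.real (A j ∩ Lk k) := by
      refine Finset.sum_le_sum fun k _ => ?_
      split_ifs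
      · exact le_rfl
      · exact measureReal_nonneg
    refine e.trans ?_
    rw [← measureReal_biUnion_finset (f := fun k => A j ∩ Lk k)]
    · exact measureReal_mono (Set.iUnion₂_subset fun k _ => Set.inter_subset_left)
    · intro k hk l hl hkl
      exact (hdis' hk hl hkl).mono Set.inter_subset_right Set.inter_subset_right
    · exact fun k _ => (hA j).inter (hLm k)
  have h3 : ∀ k ∈ F, c * (m * Real.log 2) * μ.real (Lk k)
      ≤ ∑ j ∈ E, (if j < k then μ.real (A j ∩ Lk k) else 0) := by
    intro k hk
    rw [hF, Finset.mem_Ico] at hk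
    rw [← Finset.sum_filter]
    have hEf : E.filter (fun j => j < k) = Finset.Ico (2 ^ m) k := by
      ext j; simp only [hE, Finset.mem_filter, Finset.mem_Ico]; omega
    rw [hEf]
    have e1 : ∑ j ∈ Finset.Ico (2 ^ m) k, c * (1 / ((k : ℝ) - j)) * μ.real (Lk k)
        ≤ ∑ j ∈ Finset.Ico (2 ^ m) k, μ.real (A j ∩ Lk k) := by
      refine Finset.sum_le_sum fun j hj => ?_
      rw [Finset.mem_Ico] at hj
      rw [hpair j k n (by omega) hj.2, mul_one_div]
      exact mul_le_mul_of_nonneg_right (hg j k (by omega) hj.2) measureReal_nonneg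
    refine le_trans ?_ e1
    rw [← Finset.sum_mul, ← Finset.mul_sum, sum_inv_rev _ _ (by omega)]
    refine mul_le_mul_of_nonneg_right (mul_le_mul_of_nonneg_left ?_ hc.le) measureReal_nonneg
    refine le_trans ?_ (le_Hs _)
    rw [← Real.log_pow]
    refine Real.log_le_log (by positivity) ?_
    exact_mod_cast (by omega : 2 ^ m ≤ k - 2 ^ m + 1)
  have h4 : ∑ j ∈ E, μ.real (A j) ≤ 3 * C / ψ (2 ^ m) := by
    have hps := hψ _ hm
    have : ∀ j ∈ E, μ.real (A j) ≤ C / ((2 ^ m : ℕ) * ψ (2 ^ m)) := by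
      intro j hj
      rw [hE, Finset.mem_Ico] at hj
      refine (hu j (by omega)).trans ?_
      have := hψm (2 ^ m) j hm hj.1
      have hj' : ((2 ^ m : ℕ) : ℝ) ≤ j := by exact_mod_cast hj.1
      have : (0 : ℝ) < (2 ^ m : ℕ) := by positivity
      gcongr
    refine (Finset.sum_le_card_nsmul _ _ _ this).trans (le_of_eq ?_)
    have hcard : E.card = 3 * 2 ^ m := by rw [hE, Nat.card_Ico]; omega
    rw [hcard, nsmul_eq_mul]
    push_cast
    field_simp
  have hcm : 0 ≤ c * (m * Real.log 2) := by
    have := Real.log_nonneg (by norm_num : (1 : ℝ) ≤ 2)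
    positivity
  calc _ ≤ c * (m * Real.log 2) * ∑ k ∈ F, μ.real (Lk k) := mul_le_mul_of_nonneg_left h1 hcm
    _ = ∑ k ∈ F, c * (m * Real.log 2) * μ.real (Lk k) := Finset.mul_sum _ _ _
    _ ≤ ∑ k ∈ F, ∑ j ∈ E, (if j < k then μ.real (A j ∩ Lk k) else 0) := Finset.sum_le_sum h3
    _ = ∑ j ∈ E, ∑ k ∈ F, (if j < k then μ.real (A j ∩ Lk k) else 0) := Finset.sum_comm
    _ ≤ ∑ j ∈ E, μ.real (A j) := Finset.sum_le_sum h2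
    _ ≤ _ := h4

lemma summable_log {β : ℝ} (hβ : 1 < β) :
    Summable (fun m : ℕ => 1 / ((m : ℝ) * Real.log ((m + 1 : ℕ) : ℝ) ^ β)) := by
  have hl : ∀ m : ℕ, 0 ≤ Real.log ((m + 1 : ℕ) : ℝ) := fun m => by
    refine Real.log_nonneg ?_
    push_cast; linarith [(Nat.cast_nonneg m : (0 : ℝ) ≤ m)]
  rw [← summable_condensed_iff_of_nonneg]
  · have h2 : 0 < Real.log 2 := Real.log_pos (by norm_num)
    refine Summable.of_nonneg_of_le
      (f := fun k : ℕ => (1 / (Real.log 2 / 2) ^ β) * (1 / ((k + 1 : ℕ) : ℝ) ^ β)) ?_ ?_ ?_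
    · intro k
      have := Real.rpow_nonneg (hl (2 ^ k)) β
      positivity
    · intro k
      have e : (2 : ℝ) ^ k * (1 / (((2 ^ k : ℕ) : ℝ) * Real.log ((2 ^ k + 1 : ℕ) : ℝ) ^ β))
          = 1 / Real.log ((2 ^ k + 1 : ℕ) : ℝ) ^ β := by
        push_cast; field_simp
      rw [e, one_div_mul_one_div, ← Real.mul_rpow (by positivity) (Nat.cast_nonneg _)]
      have : Real.log 2 / 2 * ((k + 1 : ℕ) : ℝ) ≤ Real.log ((2 ^ k + 1 : ℕ) : ℝ) := by
        rcases Nat.eq_zero_or_pos k with rfl | hk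
        · norm_num
          linarith
        · have h1 : k * Real.log 2 ≤ Real.log ((2 ^ k + 1 : ℕ) : ℝ) := by
            rw [← Real.log_pow]
            refine Real.log_le_log (by positivity) (by push_cast; linarith)
          have h3 : (1 : ℝ) ≤ k := by exact_mod_cast hk
          push_cast at h1 ⊢
          nlinarith
      gcongr
    · refine Summable.mul_left _ ?_
      exact (summable_nat_add_iff (f := fun k : ℕ => 1 / (k : ℝ) ^ β) 1).2
        (Real.summable_one_div_nat_rpow.2 hβ)
  · intro m
    have := Real.rpow_nonneg (hl m) β
    positivity
  · intro m n hm hmn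
    have hm0 : (0 : ℝ) < m := by positivity
    have : 0 < Real.log ((m + 1 : ℕ) : ℝ) := Real.log_pos (by push_cast; linarith)
    have h1 : (m : ℝ) ≤ n := by exact_mod_cast hmn
    have h3 : Real.log ((m + 1 : ℕ) : ℝ) ≤ Real.log ((n + 1 : ℕ) : ℝ) :=
      Real.log_le_log (by positivity) (by push_cast; linarith)
    gcongr

lemma finite_part {Ω : Type*} [MeasurableSpace Ω] {μ : Measure Ω} [IsProbabilityMeasure μ]
    {A : ℕ → Set Ω} (hA : ∀ k, MeasurableSet (A k)) {β : ℝ} (hβ : 1 < β) {g : ℕ → ℕ → ℝ}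
    {N : ℕ} {c C : ℝ} (hc : 0 < c) (hC : 0 < C) (hN : 3 ≤ N)
    (hψ : ∀ k, N ≤ k → 1 ≤ psiF β k)
    (hu : ∀ k : ℕ, N ≤ k → μ.real (A k) ≤ C / (k * psiF β k))
    (hg : ∀ j k : ℕ, N ≤ j → j < k → c / ((k : ℝ) - j) ≤ g j k)
    (hpair : ∀ j k n : ℕ, N ≤ j → j < k → μ.real (A j ∩ (A k \ ⋃ l ∈ Finset.Ioc k n, A l))
      = g j k * μ.real (A k \ ⋃ l ∈ Finset.Ioc k n, A l)) :
    ∀ᵐ ω ∂μ, ∀ᶠ k in atTop, ω ∉ A k := by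
  set U : ℕ → Set Ω := fun m => ⋃ k ∈ Finset.Ico (2 ^ (m + 1)) (2 ^ (m + 2)), A k with hU
  have h2 : 0 < Real.log 2 := Real.log_pos (by norm_num)
  have hsum : Summable (fun m => μ.real (U m)) := by
    have hs := (summable_log hβ).mul_left (3 * C / (c * Real.log 2) * 2 ^ β)
    refine hs.of_norm_bounded_eventually_nat ?_
    have hpow : Tendsto (fun m : ℕ => 2 ^ m) atTop atTop :=
      tendsto_pow_atTop_atTop_of_one_lt (r := 2) (by norm_num)
    filter_upwards [hpow.eventually_ge_atTop N, eventually_ge_atTop 4] with m hm hm4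
    have hb := block_bound hA hc hC (by omega) hψ
      (fun j k hj hk => psi_mono (by linarith) (hN.trans hj) hk) hu hg hpair hm
    rw [Real.norm_eq_abs, abs_of_nonneg measureReal_nonneg]
    have hm0 : (4 : ℝ) ≤ m := by exact_mod_cast hm4
    have hl : 0 < Real.log ((m + 1 : ℕ) : ℝ) := Real.log_pos (by push_cast; linarith)
    have hps : (Real.log ((m + 1 : ℕ) : ℝ) / 2) ^ β ≤ psiF β (2 ^ m) := by
      rw [psiF]
      refine Real.rpow_le_rpow (by positivity) ?_ (by linarith)
      push_cast
      rw [Real.log_pow, div_le_iff₀ (by norm_num), mul_comm, 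
        show (2 : ℝ) * Real.log (m * Real.log 2) = ((2 : ℕ) : ℝ) * Real.log (m * Real.log 2) by norm_num,
        ← Real.log_pow]
      refine Real.log_le_log (by positivity) ?_
      have := Real.log_two_gt_d9
      have h5 : (m : ℝ) * 0.69 ≤ m * Real.log 2 := by gcongr; linarith
      nlinarith
    rw [Real.div_rpow hl.le (by norm_num)] at hps
    have hlp : 0 < Real.log ((m + 1 : ℕ) : ℝ) ^ β := Real.rpow_pos_of_pos hl β
    have h2p : (0 : ℝ) < 2 ^ β := by positivity
    have hb2 : 3 * C / psiF β (2 ^ m) ≤ 3 * C / (Real.log ((m + 1 : ℕ) : ℝ) ^ β / 2 ^ β) := by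
      gcongr
    have hb3 := hb.trans hb2
    have hcm : 0 < c * (m * Real.log 2) := by positivity
    rw [← le_div_iff₀' hcm] at hb3
    refine hb3.trans (le_of_eq ?_)
    field_simp
  have hne : ∑' m, μ (U m) ≠ ∞ := by
    have := hsum.tsum_ofReal_ne_top
    simpa [ofReal_measureReal] using this
  filter_upwards [ae_eventually_notMem hne] with ω hω
  obtain ⟨M, hM⟩ := eventually_atTop.1 hω
  filter_upwards [eventually_ge_atTop (2 ^ (M + 1))] with k hk hkA
  have hk0 : k ≠ 0 := by have : 0 < 2 ^ (M + 1) := by positivity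
                         omega
  have h1 : M + 1 ≤ Nat.log 2 k := Nat.le_log_of_pow_le (by norm_num) hk
  refine hM (Nat.log 2 k - 1) (by omega) ?_
  simp only [hU, Set.mem_iUnion, exists_prop]
  refine ⟨k, ?_, hkA⟩
  rw [Finset.mem_Ico]
  rw [show Nat.log 2 k - 1 + 1 = Nat.log 2 k by omega, show Nat.log 2 k - 1 + 2 = Nat.log 2 k + 1 by omega]
  exact ⟨Nat.pow_log_le_self 2 hk0, Nat.lt_pow_succ_log_self (by norm_num) k⟩

lemma paley {Ω : Type*} [MeasurableSpace Ω] {μ : Measure Ω} [IsProbabilityMeasure μ]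
    {A : ℕ → Set Ω} (hA : ∀ k, MeasurableSet (A k)) (I : Finset ℕ) (w : ℕ → ℝ) (L K : ℝ)
    (hL : L = ∑ k ∈ I, w k * μ.real (A k)) (hL0 : 0 < L) (hK : 0 < K)
    (h2 : ∑ k ∈ I, ∑ j ∈ I, w k * w j * μ.real (A j ∩ A k) ≤ K * L ^ 2) :
    1 / K ≤ μ.real (⋃ k ∈ I, A k) := by
  set U := ⋃ k ∈ I, A k with hU
  have hUm : MeasurableSet U := Finset.measurableSet_biUnion _ fun l _ => hA l
  set f : ℕ → Ω → ℝ := fun k => (A k).indicator 1 with hf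
  have hindInt : ∀ s : Set Ω, MeasurableSet s → Integrable (s.indicator (1 : Ω → ℝ)) μ := fun s hs =>
    (integrable_const (1 : ℝ)).indicator hs
  set t := K * L with ht
  have hpt : ∀ ω, 0 ≤ (∑ k ∈ I, ∑ j ∈ I, w k * w j * (A j ∩ A k).indicator (1 : Ω → ℝ) ω)
      - 2 * t * (∑ k ∈ I, w k * (A k).indicator (1 : Ω → ℝ) ω) + t ^ 2 * U.indicator (1 : Ω → ℝ) ω := by
    intro ω
    have e1 : (∑ k ∈ I, ∑ j ∈ I, w k * w j * (A j ∩ A k).indicator (1 : Ω → ℝ) ω)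
        = (∑ k ∈ I, w k * (A k).indicator (1 : Ω → ℝ) ω) ^ 2 := by
      rw [sq, Finset.sum_mul_sum]
      refine Finset.sum_congr rfl fun k _ => Finset.sum_congr rfl fun j _ => ?_
      rw [Set.inter_indicator_one, Pi.mul_apply]; ring
    rw [e1]
    by_cases hω : ω ∈ U
    · rw [Set.indicator_of_mem hω, Pi.one_apply]
      nlinarith [sq_nonneg ((∑ k ∈ I, w k * (A k).indicator (1 : Ω → ℝ) ω) - t)]
    · have : (∑ k ∈ I, w k * (A k).indicator (1 : Ω → ℝ) ω) = 0 := by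
        refine Finset.sum_eq_zero fun k hk => ?_
        rw [Set.indicator_of_notMem, mul_zero]
        exact fun h => hω (Set.mem_biUnion hk h)
      rw [this, Set.indicator_of_notMem hω]; simp
  have hi : 0 ≤ ∫ ω, ((∑ k ∈ I, ∑ j ∈ I, w k * w j * (A j ∩ A k).indicator (1 : Ω → ℝ) ω)
      - 2 * t * (∑ k ∈ I, w k * (A k).indicator (1 : Ω → ℝ) ω)
      + t ^ 2 * U.indicator (1 : Ω → ℝ) ω) ∂μ := integral_nonneg fun ω => hpt ω
  have i1 : Integrable (fun ω => ∑ k ∈ I, ∑ j ∈ I, w k * w j * (A j ∩ A k).indicator (1 : Ω → ℝ) ω) μ :=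
    integrable_finsetSum _ fun k _ => integrable_finsetSum _ fun j _ =>
      (hindInt _ ((hA j).inter (hA k))).const_mul _
  have i2 : Integrable (fun ω => ∑ k ∈ I, w k * (A k).indicator (1 : Ω → ℝ) ω) μ :=
    integrable_finsetSum _ fun k _ => (hindInt _ (hA k)).const_mul _
  have i3 : Integrable (fun ω => (∑ k ∈ I, ∑ j ∈ I, w k * w j * (A j ∩ A k).indicator (1 : Ω → ℝ) ω)
      - 2 * t * (∑ k ∈ I, w k * (A k).indicator (1 : Ω → ℝ) ω)) μ := i1.sub (i2.const_mul _)
  rw [integral_add i3 ((hindInt _ hUm).const_mul _),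
    integral_sub i1 (i2.const_mul _), integral_const_mul, integral_const_mul,
    integral_indicator_one hUm, integral_finsetSum _ (fun k _ => (hindInt _ (hA k)).const_mul _),
    integral_finsetSum _ (fun k _ => integrable_finsetSum _ fun j _ =>
      (hindInt _ ((hA j).inter (hA k))).const_mul _)] at hi
  have e2 : ∑ k ∈ I, ∫ ω, w k * (A k).indicator (1 : Ω → ℝ) ω ∂μ = L := by
    rw [hL]
    refine Finset.sum_congr rfl fun k _ => ?_
    rw [integral_const_mul, integral_indicator_one (hA k)]
  have e3 : ∑ k ∈ I, ∫ ω, ∑ j ∈ I, w k * w j * (A j ∩ A k).indicator (1 : Ω → ℝ) ω ∂μ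
      = ∑ k ∈ I, ∑ j ∈ I, w k * w j * μ.real (A j ∩ A k) := by
    refine Finset.sum_congr rfl fun k _ => ?_
    rw [integral_finsetSum _ (fun j _ => (hindInt _ ((hA j).inter (hA k))).const_mul _)]
    refine Finset.sum_congr rfl fun j _ => ?_
    rw [integral_const_mul, integral_indicator_one ((hA j).inter (hA k))]
  rw [e2, e3] at hi
  have h3 : 0 ≤ K * L ^ 2 - 2 * t * L + t ^ 2 * μ.real U := by linarith
  have h4 : K * L ^ 2 * 1 ≤ K * L ^ 2 * (K * μ.real U) := by rw [ht] at h3; nlinarith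
  have h5 := le_of_mul_le_mul_left h4 (by positivity)
  rw [div_le_iff₀ hK]; linarith

lemma inner_bound {N : ℕ} {k : ℕ} (hN : 3 ≤ N) (hk : N < k) :
    ∑ j ∈ Finset.Ico N k, 1 / Real.log j * (1 / (j * (Real.log k - Real.log j))) ≤ 6 := by
  have hk0 : (3 : ℝ) < k := by exact_mod_cast (by omega : 3 < k)
  have hl1 : ∀ j : ℕ, 3 ≤ j → 1 ≤ Real.log (j : ℝ) := by
    intro j hj
    rw [Real.le_log_iff_exp_le (by positivity)]
    have : (3 : ℝ) ≤ j := by exact_mod_cast hj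
    linarith [Real.exp_one_lt_d9]
  have hlk := hl1 k (by omega)
  have hterm : ∀ j ∈ Finset.Ico N k, 1 / Real.log j * (1 / (j * (Real.log k - Real.log j)))
      ≤ 1 / Real.log k * (1 / j + 1 / j + 1 / ((k : ℝ) - j)) := by
    intro j hj
    rw [Finset.mem_Ico] at hj
    have hj0 : (3 : ℝ) ≤ j := by exact_mod_cast (by omega : 3 ≤ j)
    have hjk : (j : ℝ) < k := by exact_mod_cast hj.2
    have hlj := hl1 j (by omega)
    have hlow : ((k : ℝ) - j) / k ≤ Real.log k - Real.log j := by
      have h := log_sub_le (x := (k : ℝ)) (y := (j : ℝ)) (by linarith) (by linarith)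
      have : ((k : ℝ) - j) / k = - (((j : ℝ) - k) / k) := by ring
      linarith
    have hd : 0 < (k : ℝ) - j := by linarith
    have hpos : 0 < Real.log k - Real.log j := lt_of_lt_of_le (by positivity) hlow
    set x := Real.log (j : ℝ) with hx
    set y := Real.log (k : ℝ) - x with hy
    have e : 1 / x * (1 / (j * y)) = 1 / Real.log k * (1 / (j : ℝ) * (1 / x) + 1 / j * (1 / y)) := by
      have : Real.log (k : ℝ) = x + y := by rw [hy]; ring
      rw [this]; field_simp; ring
    rw [e]
    refine mul_le_mul_of_nonneg_left ?_ (by positivity)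
    have h1 : 1 / (j : ℝ) * (1 / x) ≤ 1 / j :=
      mul_le_of_le_one_right (by positivity) (by rw [div_le_one (by linarith)]; exact hlj)
    have h2 : 1 / (j : ℝ) * (1 / y) ≤ 1 / j * (1 / (((k : ℝ) - j) / k)) := by gcongr
    have h3 : 1 / (j : ℝ) * (1 / (((k : ℝ) - j) / k)) = 1 / j + 1 / ((k : ℝ) - j) := by
      field_simp; ring
    linarith
  refine (Finset.sum_le_sum hterm).trans ?_
  rw [← Finset.mul_sum, Finset.sum_add_distrib, Finset.sum_add_distrib, sum_inv_rev _ _ hk.le]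
  have h1 := sum_inv_le N k (by omega) hk.le
  have h2 := Hs_le (k - N)
  have h3 : Real.log ((k - N : ℕ) : ℝ) ≤ Real.log k :=
    Real.log_le_log (by exact_mod_cast (by omega : 0 < k - N)) (by exact_mod_cast Nat.sub_le k N)
  rw [one_div_mul_eq_div, div_le_iff₀ (by linarith)]
  linarith

lemma diverge {β : ℝ} (hβ : β ≤ 1) {M : ℕ} (hM : 3 ≤ M)
    (hll : ∀ k : ℕ, M ≤ k → 1 ≤ Real.log (Real.log (k : ℝ))) (x : ℝ) :
    ∃ n, M ≤ n ∧ x ≤ ∑ k ∈ Finset.Ico M n, 1 / Real.log k * (1 / (k * psiF β k)) := by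
  have key : ∀ n, M ≤ n → Real.log (Real.log (Real.log (n : ℝ))) - Real.log (Real.log (Real.log (M : ℝ)))
      ≤ ∑ k ∈ Finset.Ico M n, 1 / Real.log k * (1 / (k * psiF β k)) := by
    intro n hn
    induction n, hn using Nat.le_induction with
    | base => simp
    | succ n hn ih =>
      rw [Finset.sum_Ico_succ_top hn]
      have h1 := hll n hn
      have h2 := hll (n + 1) (by omega)
      have h3 := log_sub_le (x := Real.log (Real.log (n : ℝ))) (y := Real.log (Real.log ((n + 1 : ℕ) : ℝ)))
        (by linarith) (by linarith)
      have h4 := loglog_sub_le (k := n) (by omega)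
      have hn0 : (3 : ℝ) ≤ n := by exact_mod_cast hM.trans hn
      have hl : 0 < Real.log (n : ℝ) := Real.log_pos (by linarith)
      have h5 : psiF β n ≤ Real.log (Real.log (n : ℝ)) := by
        have := Real.rpow_le_rpow_of_exponent_le h1 hβ
        rwa [Real.rpow_one] at this
      have h6 : 0 < psiF β n := Real.rpow_pos_of_pos (by linarith) _
      have h7 : (Real.log (Real.log ((n + 1 : ℕ) : ℝ)) - Real.log (Real.log (n : ℝ))) / Real.log (Real.log (n : ℝ))
          ≤ 1 / Real.log n * (1 / (n * psiF β n)) := by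
        calc _ ≤ (1 / (n * Real.log n)) / Real.log (Real.log (n : ℝ)) := by gcongr
          _ ≤ (1 / (n * Real.log n)) / psiF β n := by gcongr
          _ = _ := by field_simp
      linarith
  have ht : Tendsto (fun n : ℕ => Real.log (Real.log (Real.log (n : ℝ)))) atTop atTop :=
    Real.tendsto_log_atTop.comp tendsto_loglog_nat
  obtain ⟨n, h1, h2⟩ := ((ht.eventually_ge_atTop (x + Real.log (Real.log (Real.log (M : ℝ))))).and
    (eventually_ge_atTop M)).exists
  exact ⟨n, h2, by linarith [key n h2]⟩

lemma infinite_part {Ω : Type*} [MeasurableSpace Ω] {μ : Measure Ω} [IsProbabilityMeasure μ]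
    {A : ℕ → Set Ω} (hA : ∀ k, MeasurableSet (A k)) {β : ℝ} (hβ : β ≤ 1) {g : ℕ → ℕ → ℝ}
    {N : ℕ} {c C : ℝ} (hc : 0 < c) (hC : 0 < C) (hN : 3 ≤ N)
    (hψ : ∀ k, N ≤ k → 1 ≤ psiF β k)
    (hl : ∀ k : ℕ, N ≤ k → c / (k * psiF β k) ≤ μ.real (A k))
    (hg : ∀ j k : ℕ, N ≤ j → j < k → 
      g j k ≤ C * (1 / (j * (Real.log k - Real.log j)) + 1 / (j * psiF β j)))
    (hpair : ∀ j k : ℕ, N ≤ j → j < k → μ.real (A j ∩ A k) = g j k * μ.real (A k)) :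
    μ {ω | ∃ᶠ k in atTop, ω ∈ A k} ≠ 0 := by
  set K := 2 * (6 * C + 6 * C + C / c) + 1 with hK
  have hKp : 0 < K := by positivity
  have hlow : ∀ᶠ M in atTop, 1 / K ≤ μ.real (⋃ k ≥ M, A k) := by
    obtain ⟨N1, hN1⟩ := eventually_atTop.1 (tendsto_loglog_nat.eventually_ge_atTop 1)
    filter_upwards [eventually_ge_atTop N, eventually_ge_atTop N1] with M hM hM1
    obtain ⟨n, hn, hdiv⟩ := diverge hβ (hN.trans hM) (fun k hk => hN1 k (hM1.trans hk)) (1 / c)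
    set w : ℕ → ℝ := fun k => 1 / Real.log k with hw
    have hl1 : ∀ j : ℕ, M ≤ j → 1 ≤ Real.log (j : ℝ) := by
      intro j hj
      have h3 : (3 : ℝ) ≤ j := by exact_mod_cast (by omega : 3 ≤ j)
      rw [Real.le_log_iff_exp_le (by linarith)]
      linarith [Real.exp_one_lt_d9]
    have hw0 : ∀ j, M ≤ j → 0 < w j := fun j hj => by
      have := hl1 j hj
      simp only [hw]; positivity
    have hw1 : ∀ j, M ≤ j → w j ≤ 1 := fun j hj => by
      have := hl1 j hj
      simp only [hw]; rw [div_le_one (by linarith)]; exact this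
    set I := Finset.Ico M n with hI
    set L := ∑ k ∈ I, w k * μ.real (A k) with hL
    have hL1 : 1 ≤ L := by
      have h1 : c * ∑ k ∈ I, 1 / Real.log k * (1 / (k * psiF β k)) ≤ L := by
        rw [Finset.mul_sum]
        refine Finset.sum_le_sum fun k hk => ?_
        rw [hI, Finset.mem_Ico] at hk
        have h2 := mul_le_mul_of_nonneg_left (hl k (hM.trans hk.1)) (hw0 k hk.1).le
        refine le_trans (le_of_eq ?_) h2
        simp only [hw]; ring
      have h2 := mul_le_mul_of_nonneg_left hdiv hc.le
      rw [mul_one_div_cancel hc.ne'] at h2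
      linarith
    have hin : ∀ k ∈ I, ∑ j ∈ Finset.Ico M k, w j * g j k ≤ 6 * C + C / c * L := by
      intro k hk
      rw [hI, Finset.mem_Ico] at hk
      rcases eq_or_lt_of_le hk.1 with rfl | hMk
      · simp only [Finset.Ico_self, Finset.sum_empty]
        have : 0 < L := by linarith
        positivity
      have h1 : ∀ j ∈ Finset.Ico M k, w j * g j k ≤
          C * (1 / Real.log j * (1 / (j * (Real.log k - Real.log j)))) + C / c * (w j * μ.real (A j)) := by
        intro j hj
        rw [Finset.mem_Ico] at hj
        have h2 := mul_le_mul_of_nonneg_left (hg j k (hM.trans hj.1) hj.2) (hw0 j hj.1).le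
        have h3 := hl j (hM.trans hj.1)
        have h4 : C * (1 / (j * psiF β j)) ≤ C / c * μ.real (A j) := by
          rw [div_mul_eq_mul_div, le_div_iff₀ hc]
          have := mul_le_mul_of_nonneg_left h3 hC.le
          refine le_trans (le_of_eq ?_) this
          ring
        have h5 := mul_le_mul_of_nonneg_left h4 (hw0 j hj.1).le
        refine h2.trans ?_
        simp only [hw] at h5 ⊢
        nlinarith
      refine (Finset.sum_le_sum h1).trans ?_
      rw [Finset.sum_add_distrib, ← Finset.mul_sum, ← Finset.mul_sum]
      have h6 := inner_bound (hN.trans hM) hMk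
      have h7 : ∑ j ∈ Finset.Ico M k, w j * μ.real (A j) ≤ L := by
        refine Finset.sum_le_sum_of_subset_of_nonneg (Finset.Ico_subset_Ico_right hk.2.le) ?_
        intro j hj _
        rw [hI, Finset.mem_Ico] at hj
        exact mul_nonneg (hw0 j hj.1).le measureReal_nonneg
      have : 0 < C / c := by positivity
      nlinarith
    have hlt : ∑ k ∈ I, ∑ j ∈ Finset.Ico M k, w k * w j * μ.real (A j ∩ A k)
        ≤ (6 * C + C / c * L) * L := by
      rw [hL, Finset.mul_sum, ← hL]
      refine Finset.sum_le_sum fun k hk => ?_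
      have hkM : M ≤ k := (Finset.mem_Ico.1 hk).1
      have h1 : ∑ j ∈ Finset.Ico M k, w k * w j * μ.real (A j ∩ A k)
          = (∑ j ∈ Finset.Ico M k, w j * g j k) * (w k * μ.real (A k)) := by
        rw [Finset.sum_mul]
        refine Finset.sum_congr rfl fun j hj => ?_
        rw [Finset.mem_Ico] at hj
        rw [hpair j k (hM.trans hj.1) hj.2]; ring
      rw [h1]
      exact mul_le_mul_of_nonneg_right (hin k hk) (mul_nonneg (hw0 k hkM).le measureReal_nonneg)
    have hlt' : ∑ k ∈ I, ∑ j ∈ I, (if j < k then w k * w j * μ.real (A j ∩ A k) else 0)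
        ≤ (6 * C + C / c * L) * L := by
      refine le_trans (le_of_eq ?_) hlt
      refine Finset.sum_congr rfl fun k hk => ?_
      rw [← Finset.sum_filter]
      refine Finset.sum_congr ?_ fun _ _ => rfl
      ext j
      simp only [hI, Finset.mem_filter, Finset.mem_Ico] at hk ⊢
      omega
    have hgt' : ∑ k ∈ I, ∑ j ∈ I, (if k < j then w k * w j * μ.real (A j ∩ A k) else 0)
        ≤ (6 * C + C / c * L) * L := by
      refine le_trans (le_of_eq ?_) hlt'
      rw [Finset.sum_comm]
      refine Finset.sum_congr rfl fun k hk => Finset.sum_congr rfl fun j hj => ?_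
      rw [Set.inter_comm, mul_comm (w k)]
    have heq : ∑ k ∈ I, ∑ j ∈ I, (if k = j then w k * w j * μ.real (A j ∩ A k) else 0) ≤ L := by
      refine Finset.sum_le_sum fun k hk => ?_
      have hkM : M ≤ k := (Finset.mem_Ico.1 hk).1
      rw [Finset.sum_ite_eq, if_pos hk, Set.inter_self, mul_assoc]
      exact mul_le_of_le_one_left (mul_nonneg (hw0 k hkM).le measureReal_nonneg) (hw1 k hkM)
    have hp := paley hA I w L K hL (by linarith) hKp (by
      have e : ∑ k ∈ I, ∑ j ∈ I, w k * w j * μ.real (A j ∩ A k) =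
          ∑ k ∈ I, ∑ j ∈ I, (if j < k then w k * w j * μ.real (A j ∩ A k) else 0)
          + ∑ k ∈ I, ∑ j ∈ I, (if k < j then w k * w j * μ.real (A j ∩ A k) else 0)
          + ∑ k ∈ I, ∑ j ∈ I, (if k = j then w k * w j * μ.real (A j ∩ A k) else 0) := by
        rw [← Finset.sum_add_distrib, ← Finset.sum_add_distrib]
        refine Finset.sum_congr rfl fun k _ => ?_
        rw [← Finset.sum_add_distrib, ← Finset.sum_add_distrib]
        refine Finset.sum_congr rfl fun j _ => ?_
        rcases lt_trichotomy j k with h | h | h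
        · simp [h, h.ne', h.not_gt]
        · simp [h]
        · simp [h, h.ne, h.not_gt]
      rw [e]
      have h1 : L ≤ L ^ 2 := by nlinarith
      have h2 : C * L ≤ C * L ^ 2 := by gcongr
      have h3 : 0 ≤ C * L ^ 2 := by positivity
      rw [hK]
      nlinarith)
    refine hp.trans (measureReal_mono ?_ (measure_ne_top _ _))
    intro ω hω
    simp only [Set.mem_iUnion, exists_prop] at hω ⊢
    obtain ⟨k, hk, h⟩ := hω
    exact ⟨k, (Finset.mem_Ico.1 hk).1, h⟩
  have hset : {ω | ∃ᶠ k in atTop, ω ∈ A k} = ⋂ M, ⋃ k ≥ M, A k := by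
    ext ω
    simp only [Set.mem_ofPred_eq, frequently_atTop, Set.mem_iInter, Set.mem_iUnion, exists_prop]
  have htend : Tendsto (fun M => μ (⋃ k ≥ M, A k)) atTop (𝓝 (μ (⋂ M, ⋃ k ≥ M, A k))) := by
    refine tendsto_measure_iInter_atTop (fun M => ?_) ?_ ⟨0, measure_ne_top _ _⟩
    · exact (MeasurableSet.iUnion fun k => MeasurableSet.iUnion fun _ => hA k).nullMeasurableSet
    · intro m n hmn
      exact Set.biUnion_subset_biUnion_left fun k (hk : n ≤ k) => hmn.trans hk
  rw [hset]
  intro h0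
  rw [h0] at htend
  have : (0 : ℝ≥0∞) < ENNReal.ofReal (1 / K) := by simp [hKp]
  obtain ⟨M, h1, h2⟩ := ((htend.eventually (gt_mem_nhds this)).and hlow).exists
  rw [← ofReal_measureReal (measure_ne_top _ _)] at h1
  exact absurd h1 (not_lt.2 (ENNReal.ofReal_le_ofReal h2))

theorem cutpoints_X_sharp_criterion
    (q p1 p2 : ℕ → ℝ)
    (hq : ∀ k, 2 ≤ k → 0 < q k) (hp1 : ∀ k, 2 ≤ k → 0 ≤ p1 k)
    (hp2 : ∀ k, 2 ≤ k → 0 < p2 k)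
    (hsum : ∀ k, 2 ≤ k → q k + p1 k + p2 k = 1)
    (μ : Measure (ℕ → ℕ)) [IsProbabilityMeasure μ]
    (hμ : IsMarkovChain μ (transX q p1 p2) 2)
    (a b : ℝ) (ha : 0 < a) (hb : 0 < b)
    (hCa : Tendsto (fun k => (p1 k + p2 k) / q k) atTop (𝓝 a))
    (hCb : Tendsto (fun k => p2 k / q k) atTop (𝓝 b))
    (β : ℝ) (hβ : 0 ≤ β)
    (hrho : (fun k => rho q p1 p2 k - (1 - 3 * rseq β k))
      =O[atTop] fun k => rseq β k ^ 2) :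
    (1 < β → μ {ω | {k : ℕ | ∃! n, ω n = k}.Finite} = 1) ∧
    (β ≤ 1 → μ {ω | {k : ℕ | ∃! n, ω n = k}.Infinite} = 1) := by
  set S := Sfun (fun k => (p1 k + p2 k) / q k) (fun k => p2 k / q k) with hS
  obtain ⟨A, hA, hcut, hup, hlo, hpair, h01⟩ := prob_interface hq hp1 hp2 hsum hμ hS
  obtain ⟨N, c, D, hN, hc, hD, H⟩ := main_bounds q p1 p2 hq hp1 hp2 hsum a ha hCa β hβ hrho
  rw [← hS] at H
  have hSpos : ∀ j n, 2 ≤ j → 1 ≤ n → 0 < S j n := by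
    intro j n hj hn
    rw [hS]
    refine Sfun_pos (fun k hk => ?_) (fun k hk => div_pos (hp2 k (by omega)) (hq k (by omega))) hn
    exact div_pos (by linarith [hp1 k (by omega), hp2 k (by omega)]) (hq k (by omega))
  have hψ : ∀ k, N ≤ k → 1 ≤ psiF β k := fun k hk => (H k hk).1
  have hjpos : ∀ j : ℕ, N ≤ j → (0 : ℝ) < j := fun j hj => by
    exact_mod_cast (by omega : 0 < j)
  constructor
  · intro hβ1
    have hfin : ∀ᵐ ω ∂μ, ∀ᶠ k in atTop, ω ∉ A k := by
      refine finite_part (g := fun j k => q j / S j (k - j)) hA hβ1 (c := c / D) (C := 1 / c)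
        (by positivity) (by positivity) hN hψ ?_ ?_ ?_
      · intro k hk
        obtain ⟨h1, h2, h3, h4, ⟨n, hn, h5⟩, h6, h7⟩ := H k hk
        have hk0 := hjpos k hk
        refine (hup k (by omega) n hn).trans ?_
        have hqk := hq k (by omega)
        calc q k / S k n ≤ 1 / (c * (k * psiF β k)) := by gcongr
          _ = _ := by field_simp
      · intro j k hj hjk
        obtain ⟨h1, h2, h3, h4, h5, h6, h7⟩ := H j hj
        have h8 := h4 (k - j)
        rw [Nat.cast_sub hjk.le] at h8
        have hp := hSpos j (k - j) (by omega) (by omega)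
        have hqj := hq j (by omega)
        have hd : (0 : ℝ) < (k : ℝ) - j := by
          have : (j : ℝ) < k := by exact_mod_cast hjk
          linarith
        calc c / D / ((k : ℝ) - j) = c / (D * (k - j)) := by rw [div_div]
          _ ≤ q j / S j (k - j) := by gcongr
      · intro j k n hj hjk
        exact hpair j k n (by omega) hjk
    have hae : ∀ᵐ ω ∂μ, {k : ℕ | ∃! n, ω n = k}.Finite := by
      filter_upwards [hfin, hcut] with ω h1 h2
      obtain ⟨M, hM⟩ := eventually_atTop.1 h1
      refine (Set.finite_lt_nat (max M 2)).subset fun k hk => ?_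
      by_contra hlt
      have hlt' : max M 2 ≤ k := not_lt.1 hlt
      exact hM k ((le_max_left _ _).trans hlt') ((h2 k ((le_max_right _ _).trans hlt')).2 hk)
    have : {ω : ℕ → ℕ | {k : ℕ | ∃! n, ω n = k}.Finite} =ᵐ[μ] Set.univ := eventuallyEq_univ.2 hae
    rw [measure_congr this, measure_univ]
  · intro hβ1
    have hne := infinite_part (μ := μ) (g := fun j k => q j / S j (k - j)) hA hβ1 (c := c / D) (C := 1 / c)
        (by positivity) (by positivity) hN hψ (by
          intro k hk
          obtain ⟨h1, h2, h3, h4, h5, h6, h7⟩ := H k hk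
          have hk0 := hjpos k hk
          refine le_trans ?_ (hlo k (by omega) _ fun n _ => h6 n)
          rw [div_div]
          gcongr) (by
          intro j k hj hjk
          obtain ⟨h1, h2, h3, h4, h5, h6, h7⟩ := H j hj
          have hj0 := hjpos j hj
          have h8 := h7 (k - j)
          rw [Nat.add_sub_cancel' hjk.le] at h8
          have hjk' : (j : ℝ) < k := by exact_mod_cast hjk
          have hlog : 0 < Real.log (k : ℝ) - Real.log j := by
            linarith [Real.log_lt_log hj0 hjk']
          set x := (j : ℝ) * (Real.log (k : ℝ) - Real.log j) with hx
          set y := (j : ℝ) * psiF β j with hy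
          have hx0 : 0 < x := by positivity
          have hy0 : 0 < y := by positivity
          have hm0 : 0 < min x y := lt_min hx0 hy0
          have hqj := hq j (by omega)
          calc q j / S j (k - j) ≤ 1 / (c * min x y) := by gcongr
            _ = 1 / c * (1 / min x y) := by rw [one_div_mul_one_div]
            _ ≤ 1 / c * (1 / x + 1 / y) := by
              have hx1 : 0 < 1 / x := by positivity
              have hy1 : 0 < 1 / y := by positivity
              refine mul_le_mul_of_nonneg_left ?_ (by positivity)
              rcases min_choice x y with h | h <;> rw [h] <;> linarith) (by
          intro j k hj hjk
          have := hpair j k k (by omega) hjk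
          simpa using this)
    have h1 : μ {ω | ∃ᶠ k in atTop, ω ∈ A k} = 1 := h01.resolve_left hne
    have hae : ∀ᵐ ω ∂μ, ∃ᶠ k in atTop, ω ∈ A k := by
      have hm : MeasurableSet {ω | ∃ᶠ k in atTop, ω ∈ A k} := by
        have hset : {ω | ∃ᶠ k in atTop, ω ∈ A k} = ⋂ M, ⋃ k ≥ M, A k := by
          ext ω
          simp only [Set.mem_ofPred_eq, frequently_atTop, Set.mem_iInter, Set.mem_iUnion, exists_prop]
        rw [hset]
        exact MeasurableSet.iInter fun M => MeasurableSet.iUnion fun k =>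
          MeasurableSet.iUnion fun _ => hA k
      exact (prob_compl_eq_zero_iff hm).2 h1
    have hae2 : ∀ᵐ ω ∂μ, {k : ℕ | ∃! n, ω n = k}.Infinite := by
      filter_upwards [hae, hcut] with ω h2 h3
      rw [← Nat.frequently_atTop_iff_infinite]
      refine (h2.and_eventually (eventually_ge_atTop 2)).mono fun k hk => (h3 k hk.2).1 hk.1
    have : {ω : ℕ → ℕ | {k : ℕ | ∃! n, ω n = k}.Infinite} =ᵐ[μ] Set.univ := eventuallyEq_univ.2 hae2
    rw [measure_congr this, measure_univ]

end
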